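/- arXiv:2108.03088 — 11 statements merged into one kernel-verified Lean document; each statement's English description precedes it below -/
import Mathlib

section
/- Let p ≥ 5 be a prime. Then the quadratic character sums λ₁ := ∑_{x ∈ F} η((x²-4)(-3x²-4)) and Γ := ∑_{x ∈ F} η(x(x-1)(x+3)) over F = GF(p^n) satisfy λ₁ = Γ - η(-3). -/
/-- Summing a function of `x ^ 2` weighs each value `u` by its number of square roots. -/
theorem sum_comp_sq_eq_sum_quadraticChar {F : Type*} [Field F] [Fintype F] [DecidableEq F]
    (hF : ringChar F ≠ 2) (g : F → ℤ) :
    ∑ x : F, g (x ^ 2) = ∑ u : F, (quadraticChar F u + 1) * g u := by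
  rw [← Finset.sum_fiberwise Finset.univ (fun x : F => x ^ 2) (fun x => g (x ^ 2))]
  refine Finset.sum_congr rfl fun u _ => ?_
  rw [← quadraticChar_card_sqrts hF u]
  rw [Finset.sum_congr rfl (g := fun _ => g u)
    (fun x hx => by rw [(Finset.mem_filter.mp hx).2])]
  rw [Finset.sum_const, nsmul_eq_mul]
  congr 3
  ext x
  simp

/-- A nonconstant affine function has vanishing quadratic character sum. -/
theorem sum_quadraticChar_affine {F : Type*} [Field F] [Fintype F] [DecidableEq F]
    (hF : ringChar F ≠ 2) {a : F} (ha : a ≠ 0) (b : F) :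
    ∑ w : F, quadraticChar F (a * w + b) = 0 := by
  rw [← quadraticChar_sum_zero hF]
  exact Equiv.sum_comp ((Equiv.mulLeft₀ a ha).trans (Equiv.addRight b))
    (fun w => quadraticChar F w)

/-- The quadratic character only depends on the class modulo nonzero squares. -/
theorem quadraticChar_eq_of_eq_mul_sq {F : Type*} [Field F] [Fintype F] [DecidableEq F]
    {a b c : F} (hc : c ≠ 0) (h : a = b * c ^ 2) :
    quadraticChar F a = quadraticChar F b := by
  rw [h, map_mul, quadraticChar_sq_one' hc, mul_one]

/-- The quadratic character sum of a split quadratic polynomial `w * (a * w + b)`. -/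
theorem sum_quadraticChar_mul_affine {F : Type*} [Field F] [Fintype F] [DecidableEq F]
    (hF : ringChar F ≠ 2) (a : F) {b : F} (hb : b ≠ 0) :
    ∑ w : F, quadraticChar F (w * (a * w + b)) = -quadraticChar F a := by
  have h := sum_quadraticChar_affine hF hb a
  rw [← Equiv.sum_comp (Equiv.inv F)] at h
  rw [← Finset.add_sum_erase _ _ (Finset.mem_univ (0 : F))] at h ⊢
  have hc : ∑ w ∈ Finset.univ.erase (0 : F), quadraticChar F (w * (a * w + b)) =
      ∑ w ∈ Finset.univ.erase (0 : F), quadraticChar F (b * Equiv.inv F w + a) := by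
    refine Finset.sum_congr rfl fun w hw => ?_
    have hw0 : w ≠ 0 := Finset.ne_of_mem_erase hw
    refine quadraticChar_eq_of_eq_mul_sq hw0 ?_
    simp only [Equiv.inv_apply]
    field_simp
    ring
  rw [hc]
  simp only [Equiv.inv_apply, inv_zero, mul_zero, zero_add, zero_mul,
    quadraticChar_zero] at h ⊢
  linarith

/-- For a prime `p ≥ 5`, the quadratic character sums
`λ₁ = ∑_{x ∈ F} η((x²-4)(-3x²-4))` and `Γ = ∑_{x ∈ F} η(x(x-1)(x+3))`
over `F = GF(p^n)` satisfy `λ₁ = Γ - η(-3)`. -/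
theorem stmt_2 (p n : ℕ) (hp : p.Prime) (hp5 : 5 ≤ p) (hn : 0 < n)
    (F : Type*) [Field F] [Fintype F]
    (hF : Fintype.card F = p ^ n)
    (η : F → ℤ)
    (hη0 : η 0 = 0)
    (hη1 : ∀ x : F, x ≠ 0 → IsSquare x → η x = 1)
    (hη2 : ∀ x : F, ¬ IsSquare x → η x = -1) :
    ∑ x : F, η ((x ^ 2 - 4) * (-3 * x ^ 2 - 4)) =
      (∑ x : F, η (x * (x - 1) * (x + 3))) - η (-3) := by
  classical
  have hη : ∀ x, η x = quadraticChar F x := by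
    intro x
    rw [quadraticChar_apply, quadraticCharFun]
    split_ifs with h0 hs
    · rw [h0, hη0]
    · exact hη1 x h0 hs
    · exact hη2 x hs
  simp only [hη]
  have hchar : ringChar F ≠ 2 := by
    intro h
    have h2 : 2 ∣ p ^ n := by
      have := FiniteField.even_card_of_char_two h
      omega
    have := (Nat.prime_dvd_prime_iff_eq Nat.prime_two hp).mp (Nat.prime_two.dvd_of_dvd_pow h2)
    omega
  have h2 : (2 : F) ≠ 0 := Ring.two_ne_zero hchar
  have h4 : (-4 : F) ≠ 0 := by
    rw [show (-4 : F) = -(2 ^ 2) by norm_num]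
    exact neg_ne_zero.mpr (pow_ne_zero 2 h2)
  have hscale : ∑ x : F, quadraticChar F ((x ^ 2 - 4) * (-3 * x ^ 2 - 4)) =
      ∑ x : F, quadraticChar F ((x ^ 2 - 1) * (-3 * x ^ 2 - 1)) := by
    rw [← Equiv.sum_comp (Equiv.mulLeft₀ (2 : F) h2)]
    refine Finset.sum_congr rfl fun x _ => ?_
    refine quadraticChar_eq_of_eq_mul_sq (pow_ne_zero 2 h2) ?_
    simp only [Equiv.mulLeft₀_apply]
    ring
  have hquad : ∑ u : F, quadraticChar F ((u - 1) * (-3 * u - 1)) = -quadraticChar F (-3) := by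
    rw [← sum_quadraticChar_mul_affine hchar (-3) h4, ← Equiv.sum_comp (Equiv.addRight (1 : F))]
    refine Finset.sum_congr rfl fun w _ => congrArg _ ?_
    simp only [Equiv.coe_addRight]
    ring
  have hcubic : ∑ u : F, quadraticChar F (u * ((u - 1) * (-3 * u - 1))) =
      ∑ v : F, quadraticChar F (v * (v - 1) * (v + 3)) := by
    rw [← Equiv.sum_comp (Equiv.inv F)]
    refine Finset.sum_congr rfl fun v _ => ?_
    by_cases hv : v = 0
    · simp [hv]
    · symm
      refine quadraticChar_eq_of_eq_mul_sq (pow_ne_zero 2 hv) ?_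
      simp only [Equiv.inv_apply]
      field_simp
      ring
  rw [hscale, sum_comp_sq_eq_sum_quadraticChar hchar
    (fun u => quadraticChar F ((u - 1) * (-3 * u - 1)))]
  simp only [add_mul, one_mul, ← map_mul, Finset.sum_add_distrib]
  rw [hquad, hcubic, sub_eq_add_neg]
end

section
/- Let p ≥ 5 be a prime. Then the quadratic character sums λ₂ := ∑_{x ∈ F} η((x²+1)(x²+4x+1)) and Γ := ∑_{x ∈ F} η(x(x-1)(x+3)) over F = GF(p^n) satisfy λ₂ = Γ - 1. -/
/-- A sum over a finite field is invariant under a nonconstant affine substitution. -/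
theorem sum_comp_affine {F M : Type*} [Field F] [Fintype F] [AddCommMonoid M] (f : F → M)
    {a : F} (ha : a ≠ 0) (b : F) : ∑ x : F, f (a * x + b) = ∑ x : F, f x :=
  Equiv.sum_comp ((Equiv.mulLeft₀ a ha).trans (Equiv.addRight b)) f

theorem quadraticChar_sq_mul {F : Type*} [Field F] [Fintype F] [DecidableEq F] {c : F}
    (hc : c ≠ 0) (x : F) : quadraticChar F (c ^ 2 * x) = quadraticChar F x := by
  rw [map_mul, quadraticChar_sq_one' hc, one_mul]

/-- The nonzero `x` with `x + x⁻¹ = u` are counted by `1 + χ(u² - 4)`. -/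
theorem card_add_inv_eq {F : Type*} [Field F] [Fintype F] [DecidableEq F]
    (h2 : ringChar F ≠ 2) (u : F) :
    ((Finset.univ.filter fun x : F => x ≠ 0 ∧ x + x⁻¹ = u).card : ℤ) =
      quadraticChar F (u ^ 2 - 4) + 1 := by
  have h20 : (2 : F) ≠ 0 := Ring.two_ne_zero h2
  rw [← quadraticChar_card_sqrts h2]
  norm_cast
  refine Finset.card_bij (fun x _ => 2 * x - u) ?_ ?_ ?_
  · intro x hx
    obtain ⟨hx0, hxu⟩ := (Finset.mem_filter.mp hx).2
    simp only [Set.mem_toFinset, Set.mem_ofPred_eq]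
    rw [← hxu]
    field_simp
    ring
  · intro x _ y _ hxy
    exact mul_left_cancel₀ h20 (sub_left_injective hxy)
  · intro y hy
    simp only [Set.mem_toFinset, Set.mem_ofPred_eq] at hy
    have key : (y + u) / 2 * (u - (y + u) / 2) = 1 := by
      field_simp
      linear_combination -hy
    have h0 : (y + u) / 2 ≠ 0 := left_ne_zero_of_mul_eq_one key
    refine ⟨(y + u) / 2, ?_, ?_⟩
    · simp only [Finset.mem_filter, Finset.mem_univ, true_and]
      refine ⟨h0, ?_⟩
      rw [inv_eq_of_mul_eq_one_right key]
      ring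
    · field_simp
      ring

theorem sum_comp_add_inv {F : Type*} [Field F] [Fintype F] [DecidableEq F]
    (h2 : ringChar F ≠ 2) (g : F → ℤ) :
    ∑ x : F, (if x = 0 then 0 else g (x + x⁻¹)) =
      ∑ u : F, g u * (quadraticChar F (u ^ 2 - 4) + 1) := by
  have h : ∀ u : F, g u * (quadraticChar F (u ^ 2 - 4) + 1) =
      ∑ x : F, if x ≠ 0 ∧ x + x⁻¹ = u then g u else 0 := by
    intro u
    rw [← card_add_inv_eq h2, ← Finset.sum_filter, Finset.sum_const, nsmul_eq_mul, mul_comm]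
  simp_rw [h]
  rw [Finset.sum_comm]
  refine Finset.sum_congr rfl fun x _ => ?_
  by_cases hx : x = 0 <;> simp [hx]

theorem sum_quadraticChar_mul_add {F : Type*} [Field F] [Fintype F] [DecidableEq F]
    (h2 : ringChar F ≠ 2) {a : F} (ha : a ≠ 0) :
    ∑ u : F, quadraticChar F (u * (u + a)) = -1 := by
  rw [← Equiv.sum_comp (Equiv.inv F)]
  have h : ∀ v : F, quadraticChar F (Equiv.inv F v * (Equiv.inv F v + a)) =
      quadraticChar F (a * v + 1) - if v = 0 then 1 else 0 := by
    intro v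
    by_cases hv : v = 0
    · simp [hv]
    · rw [if_neg hv, sub_zero, ← quadraticChar_sq_mul hv]
      congr 1
      simp only [Equiv.inv_apply]
      field_simp
      ring
  simp_rw [h]
  rw [Finset.sum_sub_distrib, sum_comp_affine (fun x => quadraticChar F x) ha,
    quadraticChar_sum_zero h2]
  simp

theorem sum_quadraticChar_quartic {F : Type*} [Field F] [Fintype F] [DecidableEq F]
    (h2 : ringChar F ≠ 2) :
    ∑ u : F, quadraticChar F (u * (u + 4) * (u ^ 2 - 4)) =
      (∑ x : F, quadraticChar F (x * (x - 1) * (x + 3))) - 1 := by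
  have h20 : (2 : F) ≠ 0 := Ring.two_ne_zero h2
  have h40 : (-4 : F) ≠ 0 := by
    rw [neg_ne_zero, show (4 : F) = 2 * 2 by norm_num]
    exact mul_ne_zero h20 h20
  rw [← Equiv.sum_comp (Equiv.inv F),
    ← sum_comp_affine (fun x => quadraticChar F (x * (x - 1) * (x + 3))) h40 (-1)]
  have h : ∀ v : F, quadraticChar F
      (Equiv.inv F v * (Equiv.inv F v + 4) * (Equiv.inv F v ^ 2 - 4)) =
      quadraticChar F ((-4 * v + -1) * (-4 * v + -1 - 1) * (-4 * v + -1 + 3)) -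
        if v = 0 then 1 else 0 := by
    intro v
    by_cases hv : v = 0
    · have : quadraticChar F ((-4 * v + -1) * (-4 * v + -1 - 1) * (-4 * v + -1 + 3)) = 1 := by
        rw [hv, ← quadraticChar_sq_one' h20]
        congr 1
        ring
      rw [this]
      simp [hv]
    · rw [if_neg hv, sub_zero,
        ← quadraticChar_sq_mul (mul_ne_zero h20 (pow_ne_zero 2 hv))]
      congr 1
      simp only [Equiv.inv_apply]
      field_simp
      ring
  simp_rw [h]
  rw [Finset.sum_sub_distrib]
  simp

theorem sum_quadraticChar_eq {F : Type*} [Field F] [Fintype F] [DecidableEq F]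
    (h2 : ringChar F ≠ 2) :
    ∑ x : F, quadraticChar F ((x ^ 2 + 1) * (x ^ 2 + 4 * x + 1)) =
      (∑ x : F, quadraticChar F (x * (x - 1) * (x + 3))) - 1 := by
  have h20 : (2 : F) ≠ 0 := Ring.two_ne_zero h2
  have h40 : (4 : F) ≠ 0 := by
    rw [show (4 : F) = 2 * 2 by norm_num]
    exact mul_ne_zero h20 h20
  have h : ∀ x : F, quadraticChar F ((x ^ 2 + 1) * (x ^ 2 + 4 * x + 1)) =
      (if x = 0 then 1 else 0) +
        if x = 0 then 0 else quadraticChar F ((x + x⁻¹) * (x + x⁻¹ + 4)) := by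
    intro x
    by_cases hx : x = 0
    · simp [hx]
    · rw [if_neg hx, if_neg hx, zero_add, ← quadraticChar_sq_mul hx ((x + x⁻¹) * _)]
      congr 1
      field_simp
      ring
  simp_rw [h]
  rw [Finset.sum_add_distrib, sum_comp_add_inv h2 fun u => quadraticChar F (u * (u + 4))]
  simp_rw [mul_add_one, ← map_mul]
  rw [Finset.sum_add_distrib, ← sum_quadraticChar_quartic h2, sum_quadraticChar_mul_add h2 h40]
  simp


/-- For a prime `p ≥ 5`, the quadratic character sums
`λ₂ = ∑_{x ∈ F} η((x²+1)(x²+4x+1))` and `Γ = ∑_{x ∈ F} η(x(x-1)(x+3))`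
over `F = GF(p^n)` satisfy `λ₂ = Γ - 1`. -/
theorem stmt_3 (p n : ℕ) (hp : p.Prime) (hp5 : 5 ≤ p) (hn : 0 < n)
    (F : Type*) [Field F] [Fintype F]
    (hF : Fintype.card F = p ^ n)
    (η : F → ℤ)
    (hη0 : η 0 = 0)
    (hη1 : ∀ x : F, x ≠ 0 → IsSquare x → η x = 1)
    (hη2 : ∀ x : F, ¬ IsSquare x → η x = -1) :
    ∑ x : F, η ((x ^ 2 + 1) * (x ^ 2 + 4 * x + 1)) =
      (∑ x : F, η (x * (x - 1) * (x + 3))) - 1 := by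
  classical
  have : Fact p.Prime := ⟨hp⟩
  have : CharP F p := charP_of_card_eq_prime_pow hF
  have h2 : ringChar F ≠ 2 := by
    rw [ringChar.eq F p]
    omega
  have hη : ∀ x, η x = quadraticChar F x := by
    intro x
    by_cases hx : x = 0
    · simp [hx, hη0]
    · by_cases hs : IsSquare x
      · rw [hη1 x hx hs, (quadraticChar_one_iff_isSquare hx).mpr hs]
      · rw [hη2 x hs, quadraticChar_neg_one_iff_not_isSquare.mpr hs]
  simp_rw [hη]
  exact sum_quadraticChar_eq h2
end

section
/- Let T₁ denote the number of roots in F = GF(p^n) of the polynomial g₁(x) = x⁴ + 2x³ + x² + 2x + 1. If η(2) = -1 then T₁ = 0. If η(2) = 1 and η(-7) = -1 then T₁ = 2. -/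
/-- In a finite field, if a product is not a square then one of the factors is a square. -/
theorem FiniteField.isSquare_or_isSquare_of_not_isSquare_mul {F : Type*} [Field F] [Fintype F]
    [DecidableEq F] {a b : F} (h : ¬ IsSquare (a * b)) : IsSquare a ∨ IsSquare b := by
  by_contra! hab
  simp only [← quadraticChar_neg_one_iff_not_isSquare, map_mul] at h hab
  simp [hab.1, hab.2] at h

/-- A root of `x⁴ + 2x³ + x² + 2x + 1` exhibits `2` as a square. -/
theorem isSquare_two_of_quartic_root {F : Type*} [Field F] {x : F}
    (hx : x ^ 4 + 2 * x ^ 3 + x ^ 2 + 2 * x + 1 = 0) : IsSquare (2 : F) := by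
  have hx0 : x ≠ 0 := by
    rintro rfl
    simp at hx
  refine ⟨(x ^ 2 + x + 1) / x, ?_⟩
  field_simp
  linear_combination -hx

/-- If `s² = 2`, `d² = -1 - 2s` and `-7` is not a square, then `x⁴ + 2x³ + x² + 2x + 1`
has exactly two roots. -/
theorem card_quartic_roots_eq_two {F : Type*} [Field F] [Fintype F] [DecidableEq F]
    (h2 : (2 : F) ≠ 0) (h7 : ¬ IsSquare (-7 : F)) {s d : F} (hs : s ^ 2 = 2)
    (hd : d ^ 2 = -1 - 2 * s) :
    (Finset.univ.filter
      (fun x : F => x ^ 4 + 2 * x ^ 3 + x ^ 2 + 2 * x + 1 = 0)).card = 2 := by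
  have hd0 : d ≠ 0 := by
    rintro rfl
    exact h7 ⟨0, by linear_combination (1 - 2 * s) * hd + 4 * hs⟩
  rw [Finset.card_eq_two]
  refine ⟨(-1 + s + d) / 2, (-1 + s - d) / 2, ?_, ?_⟩
  · intro h
    field_simp at h
    have : 2 * d = 0 := by linear_combination h
    exact (mul_ne_zero h2 hd0) this
  · ext x
    simp only [Finset.mem_filter, Finset.mem_univ, true_and, Finset.mem_insert,
      Finset.mem_singleton, eq_div_iff h2]
    have key : 4 * (x ^ 4 + 2 * x ^ 3 + x ^ 2 + 2 * x + 1) =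
        ((x * 2 - (-1 + s + d)) * (x * 2 - (-1 + s - d))) * (x ^ 2 + (1 + s) * x + 1) := by
      linear_combination (4 * x ^ 2 - (x ^ 2 + (1 + s) * x + 1)) * hs +
        (x ^ 2 + (1 + s) * x + 1) * hd
    have hne : x ^ 2 + (1 + s) * x + 1 ≠ 0 := by
      intro h
      refine h7 ⟨d * (2 * x + 1 + s), ?_⟩
      linear_combination -4 * d ^ 2 * h + (4 - d ^ 2) * hs - (-1 + 2 * s) * hd
    have h4 : (4 : F) ≠ 0 := by
      have := mul_ne_zero h2 h2
      norm_num at this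
      exact this
    rw [← mul_right_inj' h4, key, mul_zero, mul_eq_zero, mul_eq_zero, sub_eq_zero, sub_eq_zero]
    simp [hne]


/-- Let `T₁` be the number of roots in `F = GF(p^n)` of
`g₁(x) = x⁴ + 2x³ + x² + 2x + 1`.  If `η(2) = -1` then `T₁ = 0`;
if `η(2) = 1` and `η(-7) = -1` then `T₁ = 2`. -/
theorem stmt_4 (p n : ℕ) (hp : p.Prime) (hp2 : p ≠ 2) (hn : 0 < n)
    (F : Type*) [Field F] [Fintype F] [DecidableEq F]
    (hF : Fintype.card F = p ^ n)
    (η : F → ℤ)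
    (hη0 : η 0 = 0)
    (hη1 : ∀ x : F, x ≠ 0 → IsSquare x → η x = 1)
    (hη2 : ∀ x : F, ¬ IsSquare x → η x = -1) :
    (η 2 = -1 →
      (Finset.univ.filter
        (fun x : F => x ^ 4 + 2 * x ^ 3 + x ^ 2 + 2 * x + 1 = 0)).card = 0) ∧
    (η 2 = 1 → η (-7) = -1 →
      (Finset.univ.filter
        (fun x : F => x ^ 4 + 2 * x ^ 3 + x ^ 2 + 2 * x + 1 = 0)).card = 2) := by
  have h_two_ne (c : η 2 ≠ 0) : (2 : F) ≠ 0 := fun h => c (h ▸ hη0)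
  have h_not_sq (a : F) (ha : η a = -1) : ¬ IsSquare a := by
    intro hsq
    by_cases h0 : a = 0
    · subst h0
      omega
    · have := hη1 a h0 hsq
      omega
  refine ⟨fun h => ?_, fun h h7 => ?_⟩
  · rw [Finset.card_eq_zero, Finset.filter_eq_empty_iff]
    exact fun x _ hx => h_not_sq 2 h (isSquare_two_of_quartic_root hx)
  · have h2 := h_two_ne (by omega)
    have h7' := h_not_sq _ h7
    obtain ⟨s, hs⟩ : IsSquare (2 : F) := by
      by_contra hc
      have := hη2 2 hc
      omega
    have hprod : ¬ IsSquare ((-1 - 2 * s) * (-1 + 2 * s)) := by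
      have heq : (-1 - 2 * s) * (-1 + 2 * s) = -7 := by linear_combination 4 * hs
      rwa [heq]
    rcases FiniteField.isSquare_or_isSquare_of_not_isSquare_mul hprod with ⟨d, hd⟩ | ⟨d, hd⟩
    · exact card_quartic_roots_eq_two h2 h7' (s := s) (d := d) (by linear_combination -hs)
        (by linear_combination -hd)
    · exact card_quartic_roots_eq_two h2 h7' (s := -s) (d := d) (by linear_combination -hs)
        (by linear_combination -hd)
end

section
/- Let T₁ denote the number of roots in F = GF(p^n) of the polynomial g₁(x) = x⁴ + 2x³ + x² + 2x + 1. Suppose η(2) = 1 and η(-7) = 1, and let s ∈ F satisfy s² = 2. Then T₁ = 4 if η(-1 + 2s) = 1, and T₁ = 0 if η(-1 + 2s) = -1. -/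
/-- Over a ring containing a square root `s` of `2`, the quartic splits into two quadratics. -/
theorem quartic_eq_mul_of_sq_eq_two {R : Type*} [CommRing R] {s : R} (hs : s ^ 2 = 2) (x : R) :
    x ^ 4 + 2 * x ^ 3 + x ^ 2 + 2 * x + 1 =
      (x ^ 2 + (1 + s) * x + 1) * (x ^ 2 + (1 - s) * x + 1) := by
  linear_combination x ^ 2 * hs

/-- The roots of `x² + bx + 1` in terms of a square root `d` of its discriminant. -/
theorem sq_add_mul_add_one_eq_zero_iff {F : Type*} [Field F] (h2 : (2 : F) ≠ 0) {b d : F}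
    (hd : d ^ 2 = b ^ 2 - 4) (x : F) :
    x ^ 2 + b * x + 1 = 0 ↔ x = (-b + d) / 2 ∨ x = (-b - d) / 2 := by
  rw [eq_div_iff h2, eq_div_iff h2, ← sub_eq_zero (a := x * 2), ← sub_eq_zero (a := x * 2),
    ← mul_eq_zero]
  have key : (x * 2 - (-b + d)) * (x * 2 - (-b - d)) = 2 * 2 * (x ^ 2 + b * x + 1) := by
    linear_combination -hd
  rw [key]
  simp [h2]

/-- When the discriminants of both quadratic factors are nonzero squares, the quartic has four
roots. -/
theorem card_quartic_roots_eq_four {F : Type*} [Field F] [Fintype F] [DecidableEq F]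
    (h2 : (2 : F) ≠ 0) {s a c : F} (hs : s ^ 2 = 2) (ha : a ^ 2 = -1 + 2 * s)
    (hc : c ^ 2 = -1 - 2 * s) (ha0 : a ≠ 0) (hc0 : c ≠ 0) :
    (Finset.univ.filter
      (fun x : F => x ^ 4 + 2 * x ^ 3 + x ^ 2 + 2 * x + 1 = 0)).card = 4 := by
  have hs0 : s ≠ 0 := by
    rintro rfl
    exact h2 (by rw [← hs]; ring)
  have hfst := sq_add_mul_add_one_eq_zero_iff h2 (b := 1 + s) (d := a)
    (by linear_combination ha - hs)
  have hsnd := sq_add_mul_add_one_eq_zero_iff h2 (b := 1 - s) (d := c)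
    (by linear_combination hc - hs)
  have no_common (x : F) (h : x ^ 2 + (1 + s) * x + 1 = 0)
      (h' : x ^ 2 + (1 - s) * x + 1 = 0) : False := by
    have hx : 2 * s * x = 0 := by linear_combination h - h'
    obtain rfl : x = 0 := by simpa [h2, hs0] using hx
    simp at h
  have ne_of_ne_zero (b d : F) (hd : d ≠ 0) : (-b + d) / 2 ≠ (-b - d) / 2 := by
    intro h
    rw [div_left_inj' h2] at h
    exact mul_ne_zero h2 hd (by linear_combination h)
  have hset : Finset.univ.filter (fun x : F => x ^ 4 + 2 * x ^ 3 + x ^ 2 + 2 * x + 1 = 0) =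
      {(-(1 + s) + a) / 2, (-(1 + s) - a) / 2} ∪ {(-(1 - s) + c) / 2, (-(1 - s) - c) / 2} := by
    ext x
    simp only [Finset.mem_filter, Finset.mem_univ, true_and, quartic_eq_mul_of_sq_eq_two hs,
      mul_eq_zero, hfst, hsnd, Finset.mem_union, Finset.mem_insert, Finset.mem_singleton]
  rw [hset, Finset.card_union_of_disjoint, Finset.card_pair (ne_of_ne_zero _ _ ha0),
    Finset.card_pair (ne_of_ne_zero _ _ hc0)]
  rw [Finset.disjoint_left]
  intro x hx hx'
  simp only [Finset.mem_insert, Finset.mem_singleton] at hx hx'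
  exact no_common x ((hfst x).2 hx) ((hsnd x).2 hx')

/-- Let `T₁` be the number of roots in `F = GF(p^n)` of
`g₁(x) = x⁴ + 2x³ + x² + 2x + 1`.  Suppose `η(2) = 1` and `η(-7) = 1`, and
`s ∈ F` satisfies `s² = 2`.  Then `T₁ = 4` if `η(-1 + 2s) = 1`, and
`T₁ = 0` if `η(-1 + 2s) = -1`. -/
theorem stmt_6 (p n : ℕ) (hp : p.Prime) (hp2 : p ≠ 2) (hn : 0 < n)
    (F : Type*) [Field F] [Fintype F] [DecidableEq F]
    (hF : Fintype.card F = p ^ n)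
    (η : F → ℤ)
    (hη0 : η 0 = 0)
    (hη1 : ∀ x : F, x ≠ 0 → IsSquare x → η x = 1)
    (hη2 : ∀ x : F, ¬ IsSquare x → η x = -1)
    (h2 : η 2 = 1) (h7 : η (-7) = 1)
    (s : F) (hs : s ^ 2 = 2) :
    (η (-1 + 2 * s) = 1 →
      (Finset.univ.filter
        (fun x : F => x ^ 4 + 2 * x ^ 3 + x ^ 2 + 2 * x + 1 = 0)).card = 4) ∧
    (η (-1 + 2 * s) = -1 →
      (Finset.univ.filter
        (fun x : F => x ^ 4 + 2 * x ^ 3 + x ^ 2 + 2 * x + 1 = 0)).card = 0) := by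
  have ne_zero_of (x : F) (h : η x = 1) : x ≠ 0 := by
    rintro rfl
    simp [hη0] at h
  have isSquare_of (x : F) (h : η x = 1) : IsSquare x := by
    by_contra hx
    simp [hη2 x hx] at h
  have h7' := ne_zero_of _ h7
  obtain ⟨b, hb⟩ := isSquare_of _ h7
  have hprod : (-1 + 2 * s) * (-1 - 2 * s) = -7 := by linear_combination -4 * hs
  have hm0 : -1 - 2 * s ≠ 0 := right_ne_zero_of_mul (hprod ▸ h7')
  have hp0 : -1 + 2 * s ≠ 0 := left_ne_zero_of_mul (hprod ▸ h7')
  constructor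
  · intro h
    obtain ⟨a, ha⟩ := isSquare_of _ h
    have ha0 : a ≠ 0 := by
      rintro rfl
      exact hp0 (by simpa using ha)
    have hc : (b / a) ^ 2 = -1 - 2 * s := by
      rw [div_pow, div_eq_iff (pow_ne_zero 2 ha0)]
      linear_combination -hb - hprod + (-1 - 2 * s) * ha
    refine card_quartic_roots_eq_four (ne_zero_of _ h2) hs (by rw [ha, sq]) hc ha0 ?_
    intro h0
    exact hm0 (by rw [← hc, h0]; ring)
  · intro h
    have hns : ¬ IsSquare (-1 + 2 * s) := by
      intro hsq
      simp [hη1 _ hp0 hsq] at h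
    rw [Finset.card_eq_zero, Finset.filter_eq_empty_iff]
    intro x _ hx
    rw [quartic_eq_mul_of_sq_eq_two hs, mul_eq_zero] at hx
    rcases hx with hx | hx
    · exact hns ⟨2 * x + 1 + s, by linear_combination -4 * hx - hs⟩
    · have hsq : IsSquare (-1 - 2 * s) :=
        ⟨2 * x + 1 - s, by linear_combination -4 * hx - hs⟩
      have heq : -1 + 2 * s = -7 / (-1 - 2 * s) := by rw [eq_div_iff hm0, hprod]
      exact hns (heq ▸ (isSquare_of _ h7).div hsq)
end

section
/- Let d = p^n - 3 and assume p^n > 3. The number of triples (x₁, x₂, x₃) ∈ F³ with F = GF(p^n) satisfying x₁ - x₂ + x₃ = 0 and x₁^d - x₂^d + x₃^d = 0 equals p^n + (1 + T₁)(p^n - 1), where T₁ is the number of roots in F of x⁴ + 2x³ + x² + 2x + 1. -/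
/-- In a finite field with more than three elements, `x ^ (q - 3)` is the inverse of `x ^ 2`. -/
theorem FiniteField.pow_card_sub_three {F : Type*} [Field F] [Fintype F]
    (hq : 3 < Fintype.card F) (x : F) : x ^ (Fintype.card F - 3) = (x ^ 2)⁻¹ := by
  rcases eq_or_ne x 0 with rfl | hx
  · rw [zero_pow (by omega)]
    simp
  · apply eq_inv_of_mul_eq_one_left
    rw [← pow_add, show Fintype.card F - 3 + 2 = Fintype.card F - 1 by omega]
    exact FiniteField.pow_card_sub_one_eq_one x hx

theorem FiniteField.two_ne_zero_of_odd_card {F : Type*} [Field F] [Fintype F]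
    (h : Odd (Fintype.card F)) : (2 : F) ≠ 0 := by
  intro h2
  obtain ⟨k, hk⟩ := h
  have h0 := FiniteField.cast_card_eq_zero F
  rw [hk] at h0
  push_cast at h0
  simp [h2] at h0

theorem inv_sq_sub_inv_sq_add_inv_sq_eq_zero_iff {F : Type*} [Field F] (h2 : (2 : F) ≠ 0)
    {b : F} (hb : b ≠ 0) (y : F) :
    ((b * y) ^ 2)⁻¹ - ((b * (y + 1)) ^ 2)⁻¹ + (b ^ 2)⁻¹ = 0 ↔
      y = 0 ∨ y ^ 4 + 2 * y ^ 3 + y ^ 2 + 2 * y + 1 = 0 := by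
  rcases eq_or_ne y 0 with rfl | hy
  · simp
  rcases eq_or_ne (y + 1) 0 with hy1 | hy1
  · obtain rfl : y = -1 := eq_neg_of_add_eq_zero_left hy1
    have h : (b ^ 2)⁻¹ + (b ^ 2)⁻¹ ≠ 0 := by
      rw [← two_mul]
      exact mul_ne_zero h2 (inv_ne_zero (pow_ne_zero 2 hb))
    have h' : (-1 : F) ^ 4 + 2 * (-1) ^ 3 + (-1) ^ 2 + 2 * (-1) + 1 = -1 := by ring
    rw [h']
    simpa using h
  · have key : ((b * y) ^ 2)⁻¹ - ((b * (y + 1)) ^ 2)⁻¹ + (b ^ 2)⁻¹ =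
        (y ^ 4 + 2 * y ^ 3 + y ^ 2 + 2 * y + 1) * ((b * y * (y + 1)) ^ 2)⁻¹ := by
      field_simp
      ring
    rw [key]
    simp [hb, hy, hy1]

/-- With `d = p^n - 3` and `p^n > 3`, the number of triples
`(x₁,x₂,x₃) ∈ F³` with `x₁ - x₂ + x₃ = 0` and `x₁^d - x₂^d + x₃^d = 0`
equals `p^n + (1 + T₁)(p^n - 1)`, where `T₁` is the number of roots in `F`
of `x⁴ + 2x³ + x² + 2x + 1`. -/
theorem stmt_7 (p n : ℕ) (hp : p.Prime) (hp2 : p ≠ 2) (hn : 0 < n)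
    (F : Type*) [Field F] [Fintype F] [DecidableEq F]
    (hF : Fintype.card F = p ^ n)
    (hq : 3 < p ^ n) :
    (Finset.univ.filter
      (fun t : F × F × F => t.1 - t.2.1 + t.2.2 = 0 ∧
        t.1 ^ (p ^ n - 3) - t.2.1 ^ (p ^ n - 3) + t.2.2 ^ (p ^ n - 3) = 0)).card =
      p ^ n + (1 + (Finset.univ.filter
        (fun x : F => x ^ 4 + 2 * x ^ 3 + x ^ 2 + 2 * x + 1 = 0)).card) * (p ^ n - 1) := by
  have hodd : Odd (Fintype.card F) := hF ▸ (hp.odd_of_ne_two hp2).pow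
  have h2 := FiniteField.two_ne_zero_of_odd_card hodd
  rw [← hF] at hq ⊢
  simp only [FiniteField.pow_card_sub_three hq]
  set R := Finset.univ.filter (fun x : F => x ^ 4 + 2 * x ^ 3 + x ^ 2 + 2 * x + 1 = 0) with hR
  have hsplit : Finset.univ.filter (fun t : F × F × F => t.1 - t.2.1 + t.2.2 = 0 ∧
      (t.1 ^ 2)⁻¹ - (t.2.1 ^ 2)⁻¹ + (t.2.2 ^ 2)⁻¹ = 0) =
      Finset.univ.image (fun x : F => (x, x, (0 : F))) ∪
        (insert 0 R ×ˢ Finset.univ.erase (0 : F)).image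
          (fun z : F × F => (z.2 * z.1, z.2 * (z.1 + 1), z.2)) := by
    ext ⟨a, c, b⟩
    simp only [Finset.mem_filter, Finset.mem_univ, true_and, Finset.mem_union, Finset.mem_image,
      Finset.mem_product, Finset.mem_insert, Finset.mem_erase, and_true, Prod.exists,
      Prod.mk.injEq, hR]
    constructor
    · rintro ⟨h, h'⟩
      obtain rfl : c = a + b := by linear_combination -h
      rcases eq_or_ne b 0 with rfl | hb
      · exact Or.inl ⟨a, rfl, (add_zero a).symm, rfl⟩
      · have ha : b * (a / b) = a := mul_div_cancel₀ a hb
        have hc : b * (a / b + 1) = a + b := by rw [mul_add, ha, mul_one]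
        refine Or.inr ⟨a / b, b, ⟨?_, hb⟩, ha, hc, rfl⟩
        rw [← inv_sq_sub_inv_sq_add_inv_sq_eq_zero_iff h2 hb, ha, hc, h']
    · rintro (⟨x, rfl, rfl, rfl⟩ | ⟨y, b, ⟨hy, hb⟩, rfl, rfl, rfl⟩)
      · simp
      · exact ⟨by ring, (inv_sq_sub_inv_sq_add_inv_sq_eq_zero_iff h2 hb y).2 hy⟩
  rw [hsplit, Finset.card_union_of_disjoint, Finset.card_image_of_injective,
    Finset.card_image_of_injOn, Finset.card_product, Finset.card_insert_of_notMem,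
    Finset.card_erase_of_mem (Finset.mem_univ _), Finset.card_univ, add_comm 1]
  · simp [hR]
  · rintro ⟨y, b⟩ hyb ⟨y', b'⟩ - h
    simp only [Prod.mk.injEq] at h
    obtain ⟨h, -, rfl⟩ := h
    have hb : b ≠ 0 := by
      rw [Finset.mem_coe, Finset.mem_product] at hyb
      exact Finset.ne_of_mem_erase hyb.2
    rw [mul_left_cancel₀ hb h]
  · intro x y h
    exact congrArg Prod.fst h
  · rw [Finset.disjoint_left]
    rintro _ h h'
    obtain ⟨x, -, rfl⟩ := Finset.mem_image.1 h
    obtain ⟨⟨y, b⟩, hyb, h⟩ := Finset.mem_image.1 h'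
    exact Finset.ne_of_mem_erase (Finset.mem_product.1 hyb).2
      (congrArg (fun t : F × F × F => t.2.2) h)
end

section
/- Let q be an odd prime power, F = GF(q), and d a positive integer. For each b ∈ F let N(b) denote the number of x ∈ F with (x+1)^d - x^d = b, and let M be the number of quadruples (x₁, x₂, x₃, x₄) ∈ F⁴ satisfying x₁ - x₂ + x₃ - x₄ = 0 and x₁^d - x₂^d + x₃^d - x₄^d = 0. Then (q - 1)·∑_{b ∈ F} N(b)² = M - q². -/
open Finset in
/-- The second moment of the fibre sizes counts the pairs with equal image. -/
theorem sum_card_fiber_sq {α β : Type*} [Fintype α] [Fintype β] [DecidableEq β] (f : α → β) :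
    ∑ b : β, #{x | f x = b} ^ 2 = #{p : α × α | f p.1 = f p.2} := by
  classical
  rw [card_eq_sum_card_fiberwise (f := fun p : α × α => f p.1) (t := univ) (by simp)]
  refine sum_congr rfl fun b _ => ?_
  rw [sq, ← card_product]
  congr 1
  ext ⟨x, y⟩
  simp only [mem_product, mem_filter, mem_univ, true_and]
  grind

open Finset in
/-- The trivial quadruples, with `x₁ = x₂`, are determined by `x₁` and `x₃`. -/
theorem card_quadruples_fst_eq_snd (F : Type*) [Field F] [Fintype F] [DecidableEq F] (d : ℕ) :
    #{t : F × F × F × F | (t.1 - t.2.1 + t.2.2.1 - t.2.2.2 = 0 ∧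
      t.1 ^ d - t.2.1 ^ d + t.2.2.1 ^ d - t.2.2.2 ^ d = 0) ∧ t.1 = t.2.1} =
      Fintype.card F ^ 2 := by
  rw [sq, ← Fintype.card_prod, ← card_univ]
  symm
  refine card_bij' (fun p _ => (p.1, p.1, p.2, p.2)) (fun t _ => (t.1, t.2.2.1)) ?_ ?_ ?_ ?_
  · simp
  · simp
  · simp
  · rintro ⟨x, y, z, w⟩ h
    simp only [mem_filter, mem_univ, true_and] at h
    simp only [Prod.mk.injEq, true_and]
    grind

open Finset in
/-- The quadruples with `x₁ ≠ x₂` are scalings by `u = x₁ - x₂` of pairs `(y, z)` with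
`(y + 1) ^ d - y ^ d = (z + 1) ^ d - z ^ d`, via `(u (y + 1), u y, u z, u (z + 1))`. -/
theorem card_quadruples_fst_ne_snd (F : Type*) [Field F] [Fintype F] [DecidableEq F] (d : ℕ) :
    #{t : F × F × F × F | (t.1 - t.2.1 + t.2.2.1 - t.2.2.2 = 0 ∧
      t.1 ^ d - t.2.1 ^ d + t.2.2.1 ^ d - t.2.2.2 ^ d = 0) ∧ ¬t.1 = t.2.1} =
      (Fintype.card F - 1) *
        #{p : F × F | (p.1 + 1) ^ d - p.1 ^ d = (p.2 + 1) ^ d - p.2 ^ d} := by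
  rw [← card_univ, ← card_erase_of_mem (mem_univ (0 : F)), ← card_product]
  symm
  refine card_bij'
    (fun p _ => (p.1 * (p.2.1 + 1), p.1 * p.2.1, p.1 * p.2.2, p.1 * (p.2.2 + 1)))
    (fun t _ => (t.1 - t.2.1, t.2.1 / (t.1 - t.2.1), t.2.2.1 / (t.1 - t.2.1))) ?_ ?_ ?_ ?_
  · rintro ⟨u, y, z⟩ h
    simp only [mem_product, mem_erase, mem_filter, mem_univ, true_and, and_true] at h ⊢
    obtain ⟨hu, h⟩ := h
    refine ⟨⟨by ring, ?_⟩, fun e => hu (by linear_combination e)⟩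
    simp only [mul_pow]
    linear_combination u ^ d * h
  · rintro ⟨x, y, z, w⟩ h
    simp only [mem_product, mem_erase, mem_filter, mem_univ, true_and, and_true] at h ⊢
    obtain ⟨⟨h₁, h₂⟩, hne⟩ := h
    have hu : x - y ≠ 0 := sub_ne_zero.mpr hne
    have hx : y / (x - y) + 1 = x / (x - y) := by field_simp; ring
    have hw : z / (x - y) + 1 = w / (x - y) := by
      field_simp
      linear_combination h₁
    refine ⟨hu, ?_⟩
    rw [hx, hw]
    simp only [div_pow]
    rw [← sub_div, ← sub_div]
    congr 1
    linear_combination h₂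
  · rintro ⟨u, y, z⟩ h
    simp only [mem_product, mem_erase, mem_filter, mem_univ, true_and, and_true] at h
    have hu : u * (y + 1) - u * y = u := by ring
    simp only [hu, mul_div_cancel_left₀ _ h.1]
  · rintro ⟨x, y, z, w⟩ h
    simp only [mem_filter, mem_univ, true_and] at h
    obtain ⟨⟨h₁, -⟩, hne⟩ := h
    have hu : x - y ≠ 0 := sub_ne_zero.mpr hne
    simp only [mul_add, mul_one, mul_div_cancel₀ _ hu, Prod.mk.injEq, true_and]
    exact ⟨by ring, by linear_combination h₁⟩

/-- For `q = p^n` an odd prime power, `F = GF(q)` and `d ≥ 1`: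
`(q - 1) · ∑_{b ∈ F} N(b)² = M - q²`, where `N(b) = #{x : (x+1)^d - x^d = b}`
and `M` counts the quadruples `(x₁,x₂,x₃,x₄) ∈ F⁴` with
`x₁ - x₂ + x₃ - x₄ = 0` and `x₁^d - x₂^d + x₃^d - x₄^d = 0`. -/
theorem stmt_10 (p n : ℕ) (hp : p.Prime) (hp2 : p ≠ 2) (hn : 0 < n)
    (F : Type*) [Field F] [Fintype F] [DecidableEq F]
    (hF : Fintype.card F = p ^ n)
    (d : ℕ) (hd : 0 < d) :
    ((p : ℤ) ^ n - 1) *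
      ∑ b : F, ((Finset.univ.filter
        (fun x : F => (x + 1) ^ d - x ^ d = b)).card : ℤ) ^ 2 =
      ((Finset.univ.filter
        (fun t : F × F × F × F => t.1 - t.2.1 + t.2.2.1 - t.2.2.2 = 0 ∧
          t.1 ^ d - t.2.1 ^ d + t.2.2.1 ^ d - t.2.2.2 ^ d = 0)).card : ℤ)
        - ((p : ℤ) ^ n) ^ 2 := by
  have hq : ((Fintype.card F - 1 : ℕ) : ℤ) = (p : ℤ) ^ n - 1 := by
    rw [Nat.cast_sub Fintype.card_pos, hF]
    push_cast
    ring
  have hN := sum_card_fiber_sq fun x : F => (x + 1) ^ d - x ^ d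
  zify at hN
  rw [hN, ← hq, ← Finset.card_filter_add_card_filter_not (fun t : F × F × F × F => t.1 = t.2.1),
    Finset.filter_filter, Finset.filter_filter, card_quadruples_fst_eq_snd,
    card_quadruples_fst_ne_snd, hF]
  push_cast
  ring
end

section
/- Let d = p^n - 3 with p^n > 3, and for b ∈ F = GF(p^n) let N(b) be the number of x ∈ F with (x+1)^d - x^d = b. Let ω₅ be the number of b ∈ F with N(b) = 5. Then ω₅ = 2 if there exists s ∈ F with s² = 2, η(-7) = 1 and η(-1 + 2s) = 1; otherwise ω₅ = 0. -/
section QuadraticRoots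

variable {F : Type*} [Field F] [Fintype F] [DecidableEq F]

theorem card_roots_reciprocal_quadratic_le (y : F) :
    (Finset.univ.filter (fun x : F => x ^ 2 - y * x + 1 = 0)).card ≤ 2 := by
  rcases (Finset.univ.filter (fun x : F => x ^ 2 - y * x + 1 = 0)).eq_empty_or_nonempty with h | h
  · simp [h]
  · obtain ⟨a, ha⟩ := h
    simp only [Finset.mem_filter, Finset.mem_univ, true_and] at ha
    refine (Finset.card_le_card (t := {a, y - a}) fun x hx => ?_).trans Finset.card_le_two
    simp only [Finset.mem_filter, Finset.mem_univ, true_and] at hx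
    have h : (x - a) * (x - (y - a)) = 0 := by linear_combination hx - ha
    rcases mul_eq_zero.1 h with h | h
    · simp [sub_eq_zero.1 h]
    · simp [sub_eq_zero.1 h]

theorem card_roots_reciprocal_quadratic_eq_two_iff (h2 : (2 : F) ≠ 0) (y : F) :
    (Finset.univ.filter (fun x : F => x ^ 2 - y * x + 1 = 0)).card = 2 ↔
      y ^ 2 - 4 ≠ 0 ∧ IsSquare (y ^ 2 - 4) := by
  constructor
  · intro h
    obtain ⟨a, b, hab, hS⟩ := Finset.card_eq_two.1 h
    have ha : a ∈ Finset.univ.filter (fun x : F => x ^ 2 - y * x + 1 = 0) := by simp [hS]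
    have hb : b ∈ Finset.univ.filter (fun x : F => x ^ 2 - y * x + 1 = 0) := by simp [hS]
    simp only [Finset.mem_filter, Finset.mem_univ, true_and] at ha hb
    have hne := sub_ne_zero.2 hab
    have hsum : a + b = y := by
      apply mul_left_cancel₀ hne
      linear_combination ha - hb
    have hr : y ^ 2 - 4 = (a - b) * (a - b) := by
      subst hsum
      linear_combination (-4) * ha
    exact ⟨hr ▸ mul_ne_zero hne hne, a - b, hr⟩
  · rintro ⟨hne, r, hr⟩
    have hr0 : r ≠ 0 := by
      rintro rfl
      exact hne (by simpa using hr)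
    refine le_antisymm (card_roots_reciprocal_quadratic_le y) ?_
    have hab : (y + r) / 2 ≠ (y - r) / 2 := by
      intro h
      field_simp at h
      have h' : 2 * r = 0 := by linear_combination h
      exact (mul_ne_zero h2 hr0) h'
    refine (Finset.card_pair hab).ge.trans (Finset.card_le_card fun x hx => ?_)
    simp only [Finset.mem_insert, Finset.mem_singleton] at hx
    simp only [Finset.mem_filter, Finset.mem_univ, true_and]
    rcases hx with rfl | rfl
    · field_simp
      linear_combination -hr
    · field_simp
      linear_combination -hr

theorem card_roots_quartic_eq_add {s : F} (h2 : (2 : F) ≠ 0) (hs : s ^ 2 = 2) :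
    (Finset.univ.filter (fun x : F => x ^ 4 + 2 * x ^ 3 + x ^ 2 + 2 * x + 1 = 0)).card =
      (Finset.univ.filter (fun x : F => x ^ 2 - (-1 + s) * x + 1 = 0)).card +
      (Finset.univ.filter (fun x : F => x ^ 2 - (-1 - s) * x + 1 = 0)).card := by
  have hs0 : s ≠ 0 := by
    rintro rfl
    exact h2 (by simpa using hs.symm)
  rw [← Finset.card_union_of_disjoint]
  · congr 1
    ext x
    simp only [Finset.mem_filter, Finset.mem_univ, true_and, Finset.mem_union]
    rw [← mul_eq_zero]
    have : x ^ 4 + 2 * x ^ 3 + x ^ 2 + 2 * x + 1 =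
        (x ^ 2 - (-1 + s) * x + 1) * (x ^ 2 - (-1 - s) * x + 1) := by
      linear_combination x ^ 2 * hs
    rw [this]
  · rw [Finset.disjoint_left]
    intro x h h'
    simp only [Finset.mem_filter, Finset.mem_univ, true_and] at h h'
    have hx : 2 * s * x = 0 := by linear_combination h' - h
    have hx0 : x = 0 := (mul_eq_zero.1 hx).resolve_left (mul_ne_zero h2 hs0)
    simp [hx0] at h

theorem card_roots_quartic_eq_four_iff (h2 : (2 : F) ≠ 0) :
    (Finset.univ.filter (fun x : F => x ^ 4 + 2 * x ^ 3 + x ^ 2 + 2 * x + 1 = 0)).card = 4 ↔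
      ∃ s : F, s ^ 2 = 2 ∧ ((-7 : F) ≠ 0 ∧ IsSquare (-7 : F)) ∧
        (-1 + 2 * s ≠ 0 ∧ IsSquare (-1 + 2 * s)) := by
  have key : ∀ s : F, s ^ 2 = 2 →
      (-1 + s) ^ 2 - 4 = -1 - 2 * s ∧ (-1 - s) ^ 2 - 4 = -1 + 2 * s ∧
        (-7 : F) = (-1 - 2 * s) * (-1 + 2 * s) := fun s hs =>
    ⟨by linear_combination hs, by linear_combination hs, by linear_combination 4 * hs⟩
  constructor
  · intro h
    obtain ⟨x, hx⟩ : (Finset.univ.filter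
        (fun x : F => x ^ 4 + 2 * x ^ 3 + x ^ 2 + 2 * x + 1 = 0)).Nonempty := by
      rw [← Finset.card_pos]
      omega
    simp only [Finset.mem_filter, Finset.mem_univ, true_and] at hx
    have hx0 : x ≠ 0 := by
      rintro rfl
      simp at hx
    obtain ⟨s, hs⟩ : ∃ s : F, s ^ 2 = 2 := by
      refine ⟨x + x⁻¹ + 1, ?_⟩
      field_simp
      linear_combination hx
    have hadd := card_roots_quartic_eq_add h2 hs
    have h₁ := card_roots_reciprocal_quadratic_le (-1 + s)
    have h₂ := card_roots_reciprocal_quadratic_le (-1 - s)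
    obtain ⟨k₁, k₂, k₃⟩ := key s hs
    have e₁ := (card_roots_reciprocal_quadratic_eq_two_iff h2 (-1 + s)).1 (by omega)
    have e₂ := (card_roots_reciprocal_quadratic_eq_two_iff h2 (-1 - s)).1 (by omega)
    rw [k₁] at e₁
    rw [k₂] at e₂
    refine ⟨s, hs, ?_, e₂⟩
    rw [k₃]
    exact ⟨mul_ne_zero e₁.1 e₂.1, e₁.2.mul e₂.2⟩
  · rintro ⟨s, hs, h7, h⟩
    obtain ⟨k₁, k₂, k₃⟩ := key s hs
    rw [k₃] at h7
    have e₂ := (card_roots_reciprocal_quadratic_eq_two_iff h2 (-1 - s)).2 (by rwa [k₂])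
    have e₁ := (card_roots_reciprocal_quadratic_eq_two_iff h2 (-1 + s)).2 (by
      rw [k₁]
      refine ⟨left_ne_zero_of_mul h7.1, ?_⟩
      have := h7.2.div h.2
      rwa [mul_div_cancel_right₀ _ h.1] at this)
    rw [card_roots_quartic_eq_add h2 hs, e₁, e₂]

theorem card_inv_sq_sub_inv_sq_eq_neg (b : F) :
    (Finset.univ.filter (fun x : F => ((x + 1) ^ 2)⁻¹ - (x ^ 2)⁻¹ = -b)).card =
      (Finset.univ.filter (fun x : F => ((x + 1) ^ 2)⁻¹ - (x ^ 2)⁻¹ = b)).card := by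
  refine Finset.card_equiv (Equiv.subLeft (-1)) fun x => ?_
  simp only [Finset.mem_filter, Finset.mem_univ, true_and, Equiv.subLeft_apply]
  have h₁ : (-1 - x + 1) ^ 2 = x ^ 2 := by ring
  have h₂ : (-1 - x) ^ 2 = (x + 1) ^ 2 := by ring
  rw [h₁, h₂, ← neg_inj, neg_sub, neg_neg]

theorem card_inv_sq_sub_inv_sq_eq_one (h2 : (2 : F) ≠ 0) :
    (Finset.univ.filter (fun x : F => ((x + 1) ^ 2)⁻¹ - (x ^ 2)⁻¹ = 1)).card =
      (Finset.univ.filter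
        (fun x : F => x ^ 4 + 2 * x ^ 3 + x ^ 2 + 2 * x + 1 = 0)).card + 1 := by
  rw [← Finset.card_insert_of_notMem (a := (0 : F)) (by simp)]
  congr 1
  ext x
  simp only [Finset.mem_filter, Finset.mem_univ, true_and, Finset.mem_insert]
  by_cases hx : x = 0
  · simp [hx]
  by_cases hx1 : x + 1 = 0
  · obtain rfl : x = -1 := eq_neg_of_add_eq_zero_left hx1
    norm_num
    intro h
    exact h2 (by linear_combination -h)
  · simp only [hx, false_or]
    field_simp
    constructor
    · intro h
      linear_combination -h
    · intro h
      linear_combination -h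

theorem eq_one_or_neg_one_of_card_inv_sq_sub_inv_sq_eq_five {b : F}
    (hb : (Finset.univ.filter (fun x : F => ((x + 1) ^ 2)⁻¹ - (x ^ 2)⁻¹ = b)).card = 5) :
    b = 1 ∨ b = -1 := by
  by_contra! hne
  let P : Polynomial F := .C b * .X ^ 4 + .C (2 * b) * .X ^ 3 + .C b * .X ^ 2 + .C 2 * .X + .C 1
  have hP : P ≠ 0 := by
    intro h
    have := congrArg (Polynomial.eval 0) h
    simp [P] at this
  have hdeg : P.natDegree ≤ 4 := by
    simp only [P]
    compute_degree
  have hle := Polynomial.card_le_degree_of_subset_roots (p := P)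
    (Z := Finset.univ.filter (fun x : F => ((x + 1) ^ 2)⁻¹ - (x ^ 2)⁻¹ = b)) (by
      intro x hx
      have hx : ((x + 1) ^ 2)⁻¹ - (x ^ 2)⁻¹ = b := by simpa using hx
      rw [Polynomial.mem_roots hP]
      have hx0 : x ≠ 0 := by
        rintro rfl
        exact hne.1 (by simpa using hx.symm)
      have hx1 : x + 1 ≠ 0 := by
        intro h
        obtain rfl : x = -1 := eq_neg_of_add_eq_zero_left h
        exact hne.2 (by simpa using hx.symm)
      simp only [P, Polynomial.IsRoot.def, Polynomial.eval_add, Polynomial.eval_mul,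
        Polynomial.eval_C, Polynomial.eval_pow, Polynomial.eval_X]
      field_simp at hx
      linear_combination -hx)
  omega

end QuadraticRoots

/-- With `d = p^n - 3`, `p^n > 3`, `N(b) = #{x ∈ F : (x+1)^d - x^d = b}` and
`ω₅ = #{b ∈ F : N(b) = 5}`: `ω₅ = 2` if there exists `s ∈ F` with `s² = 2`,
`η(-7) = 1` and `η(-1 + 2s) = 1`; otherwise `ω₅ = 0`. -/
theorem stmt_11 (p n : ℕ) (hp : p.Prime) (hp2 : p ≠ 2) (hn : 0 < n)
    (F : Type*) [Field F] [Fintype F] [DecidableEq F]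
    (hF : Fintype.card F = p ^ n)
    (hq : 3 < p ^ n)
    (η : F → ℤ)
    (hη0 : η 0 = 0)
    (hη1 : ∀ x : F, x ≠ 0 → IsSquare x → η x = 1)
    (hη2 : ∀ x : F, ¬ IsSquare x → η x = -1) :
    ((∃ s : F, s ^ 2 = 2 ∧ η (-7) = 1 ∧ η (-1 + 2 * s) = 1) →
      (Finset.univ.filter (fun b : F =>
        (Finset.univ.filter
          (fun x : F => (x + 1) ^ (p ^ n - 3) - x ^ (p ^ n - 3) = b)).card = 5)).card = 2) ∧
    (¬ (∃ s : F, s ^ 2 = 2 ∧ η (-7) = 1 ∧ η (-1 + 2 * s) = 1) →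
      (Finset.univ.filter (fun b : F =>
        (Finset.univ.filter
          (fun x : F => (x + 1) ^ (p ^ n - 3) - x ^ (p ^ n - 3) = b)).card = 5)).card = 0) := by
  have h2 : (2 : F) ≠ 0 := by
    refine Ring.two_ne_zero fun h => ?_
    have heven := FiniteField.even_card_iff_char_two.1 h
    rw [hF] at heven
    have : Odd (p ^ n) := (hp.odd_of_ne_two hp2).pow
    rw [Nat.odd_iff] at this
    omega
  have hpow : ∀ x : F, x ^ (p ^ n - 3) = (x ^ 2)⁻¹ := by
    rw [← hF] at hq ⊢
    exact FiniteField.pow_card_sub_three hq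
  have hη : ∀ x : F, η x = 1 ↔ x ≠ 0 ∧ IsSquare x := by
    refine fun x => ⟨fun h => ⟨?_, ?_⟩, fun h => hη1 x h.1 h.2⟩
    · rintro rfl
      omega
    · by_contra hx
      have := hη2 x hx
      omega
  simp only [hpow, hη]
  rw [← card_roots_quartic_eq_four_iff h2]
  have hN := card_inv_sq_sub_inv_sq_eq_one h2
  have hN' := card_inv_sq_sub_inv_sq_eq_neg (1 : F)
  constructor
  · intro h
    have h11 : (1 : F) ≠ -1 := by
      intro h
      exact h2 (by linear_combination h)
    refine Eq.trans (congrArg Finset.card ?_) (Finset.card_pair h11)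
    ext b
    simp only [Finset.mem_filter, Finset.mem_univ, true_and, Finset.mem_insert,
      Finset.mem_singleton]
    refine ⟨eq_one_or_neg_one_of_card_inv_sq_sub_inv_sq_eq_five, ?_⟩
    rintro (rfl | rfl) <;> omega
  · intro h
    rw [Finset.card_eq_zero, Finset.filter_eq_empty_iff]
    intro b _ hb
    rcases eq_one_or_neg_one_of_card_inv_sq_sub_inv_sq_eq_five hb with rfl | rfl <;> omega
end

section
/- Let b ∈ F = GF(p^n) with b ∉ {0, 1, -1}, and let g_b(x) = x⁴ + 2x³ + x² + 2b⁻¹x + b⁻¹ ∈ F[x]. Then g_b has a multiple root in F (i.e., there exists x₀ ∈ F with g_b(x₀) = 0 and g_b′(x₀) = 0) if and only if p ≠ 7, η(-3) = 1, and b² = -27 in F. -/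
/-- For `b ∈ F = GF(p^n)` with `b ∉ {0, 1, -1}`, the polynomial
`g_b(x) = x⁴ + 2x³ + x² + 2b⁻¹x + b⁻¹` has a multiple root in `F`
(a common root of `g_b` and its formal derivative `4x³ + 6x² + 2x + 2b⁻¹`)
iff `p ≠ 7`, `η(-3) = 1` and `b² = -27`. -/
theorem stmt_12 (p n : ℕ) (hp : p.Prime) (hp2 : p ≠ 2) (hn : 0 < n)
    (F : Type*) [Field F] [Fintype F]
    (hF : Fintype.card F = p ^ n)
    (η : F → ℤ)
    (hη0 : η 0 = 0)
    (hη1 : ∀ x : F, x ≠ 0 → IsSquare x → η x = 1)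
    (hη2 : ∀ x : F, ¬ IsSquare x → η x = -1)
    (b : F) (hb0 : b ≠ 0) (hb1 : b ≠ 1) (hbm1 : b ≠ -1) :
    (∃ x₀ : F,
      x₀ ^ 4 + 2 * x₀ ^ 3 + x₀ ^ 2 + 2 * b⁻¹ * x₀ + b⁻¹ = 0 ∧
      4 * x₀ ^ 3 + 6 * x₀ ^ 2 + 2 * x₀ + 2 * b⁻¹ = 0) ↔
    (p ≠ 7 ∧ η (-3) = 1 ∧ b ^ 2 = -27) := by
  have hpF : (p : F) = 0 := by
    have h : ((Fintype.card F : ℕ) : F) = 0 := Nat.cast_card_eq_zero F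
    rw [hF, Nat.cast_pow] at h
    exact eq_zero_of_pow_eq_zero h
  have h2 : (2 : F) ≠ 0 := by
    intro h
    obtain ⟨k, hk⟩ := hp.odd_of_ne_two hp2
    rw [hk] at hpF
    push_cast at hpF
    simp [h] at hpF
  have hbc : b * b⁻¹ = 1 := mul_inv_cancel₀ hb0
  have hc0 : b⁻¹ ≠ 0 := inv_ne_zero hb0
  generalize b⁻¹ = c at hbc hc0 ⊢
  constructor
  · rintro ⟨x, hg, hg'⟩
    have hc : c = -(x * (x + 1) * (2 * x + 1)) :=
      mul_left_cancel₀ h2 (by linear_combination hg')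
    have hx : x * (x + 1) ≠ 0 := by
      intro h
      exact hc0 (by rw [hc, h]; ring)
    have hq : 3 * x ^ 2 + 3 * x + 1 = 0 := by
      refine (mul_eq_zero.mp ?_).resolve_left hx
      rw [hc] at hg
      linear_combination -hg
    have h3 : (3 : F) ≠ 0 := by
      intro h
      simp [h] at hq
    have hs : (-3 : F) = (3 * (2 * x + 1)) * (3 * (2 * x + 1)) := by
      linear_combination -12 * hq
    have h3c : 3 * c = 2 * x + 1 := by
      rw [hc]
      linear_combination -(2 * x + 1) * hq
    have hcc : 27 * c ^ 2 = -1 := by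
      linear_combination 3 * (3 * c + 2 * x + 1) * h3c + 4 * hq
    have hb : b ^ 2 = -27 := by
      linear_combination b ^ 2 * hcc - 27 * (b * c + 1) * hbc
    refine ⟨?_, hη1 _ (neg_ne_zero.mpr h3) ⟨_, hs⟩, hb⟩
    rintro rfl
    have hb' : b ^ 2 = 1 := by
      push_cast at hpF
      linear_combination hb - 4 * hpF
    exact (eq_or_eq_neg_of_sq_eq_sq b 1 (by rw [hb', one_pow])).elim hb1 hbm1
  · rintro ⟨-, -, hb⟩
    have hcc : 27 * c ^ 2 = -1 := by
      linear_combination c ^ 2 * hb - (b * c + 1) * hbc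
    obtain ⟨x, hx⟩ : ∃ x : F, 2 * x = 3 * c - 1 :=
      ⟨(3 * c - 1) / 2, mul_div_cancel₀ _ h2⟩
    have h3c : 3 * c = 2 * x + 1 := by linear_combination -hx
    have h4 : (4 : F) ≠ 0 := by
      have := mul_ne_zero h2 h2
      norm_num at this
      exact this
    have hq : 3 * x ^ 2 + 3 * x + 1 = 0 :=
      mul_left_cancel₀ h4 (by
        linear_combination hcc - 3 * (3 * c + 2 * x + 1) * h3c)
    have h3 : (3 : F) ≠ 0 := by
      intro h
      simp [h] at hq
    have hc : c = -(x * (x + 1) * (2 * x + 1)) :=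
      mul_left_cancel₀ h3 (by linear_combination h3c + (2 * x + 1) * hq)
    refine ⟨x, ?_, ?_⟩
    · rw [hc]
      linear_combination -(x * (x + 1)) * hq
    · rw [hc]
      ring
end

section
/- Let b ∈ F = GF(p^n) with b ∉ {0, 1, -1}, and let T_b be the number of roots in F of g_b(x) = x⁴ + 2x³ + x² + 2b⁻¹x + b⁻¹. Then T_b = 3 if and only if p ≠ 7, η(-3) = 1, η(-2) = 1, and b² = -27 in F. -/
/-- If the quartic `y⁴ - 2y² + 16cy + 1` has roots `a`, `u` and `-2a - u` with `a`, `u` distinct,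
so that `a` is a double root, then `3a² = -1`, `a = 3c` and `(3a(u + a))² = -8`. -/
lemma double_root_relations {F : Type*} [Field F] (h2 : (2 : F) ≠ 0) {a u v c : F} (hc : c ≠ 0)
    (hau : a ≠ u) (hav : a ≠ v) (huv : u ≠ v) (hsum : 2 * a + u + v = 0)
    (ha : a ^ 4 - 2 * a ^ 2 + 16 * c * a + 1 = 0)
    (hu : u ^ 4 - 2 * u ^ 2 + 16 * c * u + 1 = 0)
    (hv : v ^ 4 - 2 * v ^ 2 + 16 * c * v + 1 = 0) :
    3 * a ^ 2 = -1 ∧ a = 3 * c ∧ (3 * a * (u + a)) ^ 2 = -8 := by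
  have hfu : a ^ 3 + a ^ 2 * u + a * u ^ 2 + u ^ 3 - 2 * (a + u) + 16 * c = 0 :=
    mul_left_cancel₀ (sub_ne_zero.2 hau) (by linear_combination ha - hu)
  have hfv : a ^ 3 + a ^ 2 * v + a * v ^ 2 + v ^ 3 - 2 * (a + v) + 16 * c = 0 :=
    mul_left_cancel₀ (sub_ne_zero.2 hav) (by linear_combination ha - hv)
  have hsq : a ^ 2 + u ^ 2 + v ^ 2 + a * u + a * v + u * v - 2 = 0 :=
    mul_left_cancel₀ (sub_ne_zero.2 huv) (by linear_combination hfu - hfv)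
  obtain rfl : v = -2 * a - u := by linear_combination hsum
  have h4 : 4 * c = a * (1 - a ^ 2) :=
    mul_left_cancel₀ (mul_ne_zero h2 h2) (by linear_combination hfu + (a - u) * hsq)
  have h3 : 3 * a ^ 2 = -1 := by
    have hprod : (1 - a ^ 2) * (3 * a ^ 2 + 1) = 0 := by linear_combination ha - 4 * a * h4
    rcases mul_eq_zero.1 hprod with h | h
    · rw [h, mul_zero] at h4
      exact absurd h4 (mul_ne_zero (by convert mul_ne_zero h2 h2 using 1; norm_num) hc)
    · linear_combination h
  refine ⟨h3, mul_left_cancel₀ (mul_ne_zero h2 h2) ?_, ?_⟩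
  · linear_combination -3 * h4 + a * h3
  · linear_combination 9 * a ^ 2 * hsq + (8 - 6 * a ^ 2) * h3

/-- If `y⁴ - 2y² + 16cy + 1` has distinct roots `r`, `s`, `t`, then `-(r + s + t)` is a root. -/
lemma neg_sum_is_root {F : Type*} [Field F] {r s t c : F}
    (hrs : r ≠ s) (hrt : r ≠ t) (hst : s ≠ t)
    (hr : r ^ 4 - 2 * r ^ 2 + 16 * c * r + 1 = 0)
    (hs : s ^ 4 - 2 * s ^ 2 + 16 * c * s + 1 = 0)
    (ht : t ^ 4 - 2 * t ^ 2 + 16 * c * t + 1 = 0) :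
    (-(r + s + t)) ^ 4 - 2 * (-(r + s + t)) ^ 2 + 16 * c * (-(r + s + t)) + 1 = 0 := by
  have hfs : r ^ 3 + r ^ 2 * s + r * s ^ 2 + s ^ 3 - 2 * (r + s) + 16 * c = 0 :=
    mul_left_cancel₀ (sub_ne_zero.2 hrs) (by linear_combination hr - hs)
  have hft : r ^ 3 + r ^ 2 * t + r * t ^ 2 + t ^ 3 - 2 * (r + t) + 16 * c = 0 :=
    mul_left_cancel₀ (sub_ne_zero.2 hrt) (by linear_combination hr - ht)
  have hsq : r ^ 2 + s ^ 2 + t ^ 2 + r * s + r * t + s * t - 2 = 0 :=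
    mul_left_cancel₀ (sub_ne_zero.2 hst) (by linear_combination hfs - hft)
  linear_combination hr + (-(r + s + t) - r) * hfs +
    (-(r + s + t) - r) * (-(r + s + t) - s) * hsq

/-- If `y⁴ - 2y² + 16cy + 1` has exactly three roots, then `27c² = -1` and `-8` is a
square. -/
lemma relations_of_three_roots {F : Type*} [Field F] (h2 : (2 : F) ≠ 0) {c r s t : F}
    (hc : c ≠ 0) (hrs : r ≠ s) (hrt : r ≠ t) (hst : s ≠ t)
    (h : ∀ y : F, y ^ 4 - 2 * y ^ 2 + 16 * c * y + 1 = 0 ↔ y = r ∨ y = s ∨ y = t) :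
    27 * c ^ 2 = -1 ∧ ∃ w : F, w ^ 2 = -8 := by
  have key : ∃ a u : F, 3 * a ^ 2 = -1 ∧ a = 3 * c ∧ (3 * a * (u + a)) ^ 2 = -8 := by
    have hr := (h r).2 (by simp)
    have hs := (h s).2 (by simp)
    have ht := (h t).2 (by simp)
    rcases (h _).1 (neg_sum_is_root hrs hrt hst hr hs ht) with h4 | h4 | h4
    · exact ⟨r, s, double_root_relations h2 hc hrs hrt hst (by linear_combination -h4) hr hs ht⟩
    · exact ⟨s, r, double_root_relations h2 hc hrs.symm hst hrt (by linear_combination -h4)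
        hs hr ht⟩
    · exact ⟨t, r, double_root_relations h2 hc hrt.symm hst.symm hrs (by linear_combination -h4)
        ht hr hs⟩
  obtain ⟨a, u, h3, rfl, hw⟩ := key
  exact ⟨by linear_combination h3, _, hw⟩

/-- If `3t² = -1` and `s² = -2`, then `x⁴ + 2x³ + x² + 2t³x + t³` has exactly three roots. -/
lemma card_roots_eq_three {F : Type*} [Field F] [Fintype F] [DecidableEq F] (h2 : (2 : F) ≠ 0)
    {s t : F} (ht : 3 * t ^ 2 = -1) (hs : s ^ 2 = -2) :
    (Finset.univ.filter
      (fun x : F => x ^ 4 + 2 * x ^ 3 + x ^ 2 + 2 * t ^ 3 * x + t ^ 3 = 0)).card = 3 := by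
  have ht0 : t ≠ 0 := by rintro rfl; simp at ht
  have hs0 : s ≠ 0 := by
    rintro rfl
    exact h2 (by linear_combination hs)
  have h16 : (16 : F) ≠ 0 := by convert pow_ne_zero 4 h2 using 1; norm_num
  refine Finset.card_eq_three.2
    ⟨(-t - 1) / 2, (t + 2 * s * t - 1) / 2, (t - 2 * s * t - 1) / 2, ?_, ?_, ?_, ?_⟩
  · intro h
    field_simp at h
    have h1 : 1 + s = 0 := mul_left_cancel₀ (mul_ne_zero h2 ht0) (by linear_combination -h)
    have h3 : (3 : F) = 0 := by linear_combination (1 - s) * h1 + hs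
    simp [h3] at ht
  · intro h
    field_simp at h
    have h1 : 1 - s = 0 := mul_left_cancel₀ (mul_ne_zero h2 ht0) (by linear_combination -h)
    have h3 : (3 : F) = 0 := by linear_combination (s + 1) * h1 + hs
    simp [h3] at ht
  · intro h
    field_simp at h
    exact mul_ne_zero (mul_ne_zero (mul_ne_zero h2 h2) hs0) ht0 (by linear_combination h)
  · ext x
    have hfac : 16 * (x ^ 4 + 2 * x ^ 3 + x ^ 2 + 2 * t ^ 3 * x + t ^ 3) =
        (2 * x + 1 + t) ^ 2 * ((2 * x + 1 - t - 2 * s * t) * (2 * x + 1 - t + 2 * s * t)) := by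
      linear_combination (4 * t ^ 2 * (2 * x + 1 + t) ^ 2) * hs +
        (-2 * (2 * x + 1) ^ 2 - 3 * t ^ 2 + 1) * ht
    have e1 : x = (-t - 1) / 2 ↔ 2 * x + 1 + t = 0 := by
      rw [eq_div_iff h2]
      constructor <;> intro h <;> linear_combination h
    have e2 : x = (t + 2 * s * t - 1) / 2 ↔ 2 * x + 1 - t - 2 * s * t = 0 := by
      rw [eq_div_iff h2]
      constructor <;> intro h <;> linear_combination h
    have e3 : x = (t - 2 * s * t - 1) / 2 ↔ 2 * x + 1 - t + 2 * s * t = 0 := by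
      rw [eq_div_iff h2]
      constructor <;> intro h <;> linear_combination h
    rw [Finset.mem_filter_univ, ← mul_right_inj' h16, mul_zero, hfac]
    simp [e1, e2, e3]


/-- For `b ∈ F = GF(p^n)` with `b ∉ {0, 1, -1}`, let `T_b` be the number of
roots in `F` of `g_b(x) = x⁴ + 2x³ + x² + 2b⁻¹x + b⁻¹`.  Then `T_b = 3` iff
`p ≠ 7`, `η(-3) = 1`, `η(-2) = 1` and `b² = -27`. -/
theorem stmt_13 (p n : ℕ) (hp : p.Prime) (hp2 : p ≠ 2) (hn : 0 < n)
    (F : Type*) [Field F] [Fintype F] [DecidableEq F]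
    (hF : Fintype.card F = p ^ n)
    (η : F → ℤ)
    (hη0 : η 0 = 0)
    (hη1 : ∀ x : F, x ≠ 0 → IsSquare x → η x = 1)
    (hη2 : ∀ x : F, ¬ IsSquare x → η x = -1)
    (b : F) (hb0 : b ≠ 0) (hb1 : b ≠ 1) (hbm1 : b ≠ -1) :
    (Finset.univ.filter
      (fun x : F => x ^ 4 + 2 * x ^ 3 + x ^ 2 + 2 * b⁻¹ * x + b⁻¹ = 0)).card = 3 ↔
    (p ≠ 7 ∧ η (-3) = 1 ∧ η (-2) = 1 ∧ b ^ 2 = -27) := by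
  have hpF : (p : F) = 0 := by
    have h := Nat.cast_card_eq_zero F
    rw [hF, Nat.cast_pow] at h
    exact eq_zero_of_pow_eq_zero h
  have hchar : CharP F p := by
    obtain ⟨q, hq⟩ := CharP.exists F
    rcases (Nat.dvd_prime hp).1 ((CharP.cast_eq_zero_iff F q p).1 hpF) with h | h
    · exact absurd h (CharP.char_ne_one F q)
    · exact h ▸ hq
  have h2 : (2 : F) ≠ 0 := fun h ↦ hp2 <| (Nat.prime_dvd_prime_iff_eq hp Nat.prime_two).1 <|
    (CharP.cast_eq_zero_iff F p 2).1 (by exact_mod_cast h)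
  constructor
  · intro hcard
    obtain ⟨x, y, z, hxy, hxz, hyz, hset⟩ := Finset.card_eq_three.1 hcard
    have hroot : ∀ v : F, v ^ 4 - 2 * v ^ 2 + 16 * b⁻¹ * v + 1 = 0 ↔
        v = 2 * x + 1 ∨ v = 2 * y + 1 ∨ v = 2 * z + 1 := by
      intro v
      obtain ⟨w, rfl⟩ : ∃ w, v = 2 * w + 1 := ⟨(v - 1) / 2, by field_simp; ring⟩
      have h16 : (16 : F) ≠ 0 := by convert pow_ne_zero 4 h2 using 1; norm_num
      have hw := Finset.ext_iff.1 hset w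
      rw [Finset.mem_filter_univ, ← mul_right_inj' h16, mul_zero] at hw
      simp only [Finset.mem_insert, Finset.mem_singleton] at hw
      simp only [add_left_inj, mul_right_inj' h2, ← hw]
      ring_nf
    have hne {u v : F} (h : u ≠ v) : 2 * u + 1 ≠ 2 * v + 1 := by simpa [h2] using h
    obtain ⟨h27, w, hw⟩ :=
      relations_of_three_roots h2 (inv_ne_zero hb0) (hne hxy) (hne hxz) (hne hyz) hroot
    have hb : b ^ 2 = -27 := by
      field_simp at h27
      linear_combination h27
    refine ⟨?_, hη1 _ ?_ ⟨9 * b⁻¹, ?_⟩, hη1 _ (neg_ne_zero.2 h2) ⟨w / 2, ?_⟩, hb⟩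
    · rintro rfl
      have h7 : (7 : F) = 0 := by exact_mod_cast hpF
      have hb' : b * b = 1 := by linear_combination hb - 4 * h7
      rcases mul_self_eq_one_iff.1 hb' with h | h
      · exact hb1 h
      · exact hbm1 h
    · intro h
      exact hb0 (pow_eq_zero_iff two_ne_zero |>.1 (by linear_combination hb + 9 * h))
    · linear_combination -3 * h27
    · field_simp
      linear_combination -hw
  · rintro ⟨-, -, hs, hb⟩
    obtain ⟨s, hs⟩ : IsSquare (-2 : F) := by
      by_contra h
      simp [hη2 _ h] at hs
    have h3 : (3 : F) ≠ 0 := fun h ↦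
      hb0 (pow_eq_zero_iff two_ne_zero |>.1 (by linear_combination hb - 9 * h))
    have h9 : (9 : F) ≠ 0 := by convert pow_ne_zero 2 h3 using 1; norm_num
    have ht : 3 * (b / 9) ^ 2 = -1 := by
      field_simp
      linear_combination 3 * hb
    have hinv : b⁻¹ = (b / 9) ^ 3 := by
      field_simp
      linear_combination (27 - b ^ 2) * hb
    rw [hinv]
    exact card_roots_eq_three h2 ht (by linear_combination -hs)
end

section
/- Let A = {a ∈ F : η(a² - 4) = 1 and η(-3a² - 4) = -1} and B = {b ∈ F, b ≠ 0 : the polynomial g_b(x) = x⁴ + 2x³ + x² + 2b⁻¹x + b⁻¹ has exactly 2 roots in F}, where F = GF(p^n). Then |A| = |B| (there is a one-to-one correspondence between B and A). -/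
lemma ne_neg_self_of_two_ne_zero {F : Type*} [Field F] (h2 : (2 : F) ≠ 0) {a : F} (ha : a ≠ 0) :
    a ≠ -a := by
  intro h
  exact mul_ne_zero h2 ha (by linear_combination h)

/-- A map from `s` onto `t` with all fibres of the form `{x, σ x}`, `σ x ≠ x`, is two-to-one. -/
lemma card_eq_two_mul_card_of_fiber_eq_pair {α β : Type*} [DecidableEq α] [DecidableEq β]
    {s : Finset α} {t : Finset β} (f : α → β) (σ : α → α) (hf : ∀ x ∈ s, f x ∈ t)
    (hσ : ∀ x ∈ s, σ x ∈ s ∧ f (σ x) = f x ∧ x ≠ σ x)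
    (hinj : ∀ x ∈ s, ∀ x' ∈ s, f x' = f x → x' = x ∨ x' = σ x)
    (hsurj : ∀ b ∈ t, ∃ x ∈ s, f x = b) : s.card = 2 * t.card := by
  rw [Finset.card_eq_sum_card_fiberwise (f := f) (t := t) hf, mul_comm, ← smul_eq_mul]
  refine Finset.sum_eq_card_nsmul fun b hb => ?_
  obtain ⟨x, hx, rfl⟩ := hsurj b hb
  obtain ⟨h1, h2, h3⟩ := hσ x hx
  rw [← Finset.card_pair h3]
  congr 1
  ext x'
  simp only [Finset.mem_filter, Finset.mem_insert, Finset.mem_singleton]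
  constructor
  · exact fun h => hinj x hx x' h.1 h.2
  · rintro (rfl | rfl)
    · exact ⟨hx, rfl⟩
    · exact ⟨h1, h2⟩

section QuarticCount

variable {F : Type*} [Field F] [Fintype F] [DecidableEq F]

/-- In a finite field the product of two nonsquares is a square. -/
lemma isSquare_mul_of_not_isSquare {x y : F} (hx : ¬ IsSquare x) (hy : ¬ IsSquare y) :
    IsSquare (x * y) := by
  have hx' := quadraticChar_neg_one_iff_not_isSquare.mpr hx
  have hy' := quadraticChar_neg_one_iff_not_isSquare.mpr hy
  by_contra h
  have := quadraticChar_neg_one_iff_not_isSquare.mpr h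
  rw [map_mul, hx', hy'] at this
  norm_num at this

/-- The roots of the quartic `y⁴ - 2y² + 1 - dy`. -/
def depressedRoots (d : F) : Finset F :=
  Finset.univ.filter fun y : F => y ^ 4 - 2 * y ^ 2 + 1 - d * y = 0

lemma mem_depressedRoots {d y : F} :
    y ∈ depressedRoots d ↔ y ^ 4 - 2 * y ^ 2 + 1 - d * y = 0 := by
  simp [depressedRoots]

/-- The pairs `(a, s)` with `s` a nonzero square root of `a² - 4` and `-3a² - 4` a nonsquare. -/
noncomputable def rootPairs (F : Type*) [Field F] [Fintype F] [DecidableEq F] : Finset (F × F) :=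
  open Classical in
  Finset.univ.filter fun q : F × F =>
    q.2 ^ 2 = q.1 ^ 2 - 4 ∧ q.2 ≠ 0 ∧ ¬ IsSquare (-3 * q.1 ^ 2 - 4)

lemma mem_rootPairs {a s : F} :
    (a, s) ∈ rootPairs F ↔ s ^ 2 = a ^ 2 - 4 ∧ s ≠ 0 ∧ ¬ IsSquare (-3 * a ^ 2 - 4) := by
  simp [rootPairs]

lemma neg_fst_mem_rootPairs {a s : F} (h : (a, s) ∈ rootPairs F) : (-a, s) ∈ rootPairs F := by
  simpa [mem_rootPairs] using h

lemma neg_snd_mem_rootPairs {a s : F} (h : (a, s) ∈ rootPairs F) : (a, -s) ∈ rootPairs F := by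
  simpa [mem_rootPairs] using h

lemma fst_ne_zero_of_mem_rootPairs {a s : F} (h : (a, s) ∈ rootPairs F) : a ≠ 0 := by
  rintro rfl
  obtain ⟨h1, -, h3⟩ := mem_rootPairs.mp h
  exact h3 ⟨s, by linear_combination -h1⟩

/-- The quartic attached to `a² s` splits into two quadratics over `F`. -/
lemma mem_depressedRoots_iff {a s : F} (h2 : (2 : F) ≠ 0) (hs : s ^ 2 = a ^ 2 - 4) (y : F) :
    y ∈ depressedRoots (a ^ 2 * s) ↔
      (2 * y + a) ^ 2 = -s * (2 * a + s) ∨ (2 * y - a) ^ 2 = s * (2 * a - s) := by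
  have h16 : (16 : F) ≠ 0 := by
    have := pow_ne_zero 4 h2
    norm_num at this
    exact this
  have key : 16 * (y ^ 4 - 2 * y ^ 2 + 1 - a ^ 2 * s * y) =
      ((2 * y + a) ^ 2 - -s * (2 * a + s)) * ((2 * y - a) ^ 2 - s * (2 * a - s)) := by
    linear_combination (-8 * y ^ 2 + 4 + a ^ 2 - s ^ 2) * hs
  rw [mem_depressedRoots, ← mul_right_inj' h16, mul_zero, key, mul_eq_zero, sub_eq_zero,
    sub_eq_zero]

/-- Up to the sign of `a`, the roots attached to `(a, s)` are two elements with sum `-a`. -/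
lemma depressedRoots_eq_of_isSquare {a s : F} (h2 : (2 : F) ≠ 0) (h : (a, s) ∈ rootPairs F)
    (hD : IsSquare (-s * (2 * a + s))) :
    ∃ y z : F, y ≠ z ∧ depressedRoots (a ^ 2 * s) = {y, z} ∧ y + z = -a := by
  obtain ⟨h1, hs, hns⟩ := mem_rootPairs.mp h
  obtain ⟨e, he⟩ := hD
  have hprod : e * e * (s * (2 * a - s)) = s ^ 2 * (-3 * a ^ 2 - 4) := by
    linear_combination -s * (2 * a - s) * he + s ^ 2 * h1
  have he0 : e ≠ 0 := by
    rintro rfl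
    have : -3 * a ^ 2 - 4 = 0 := by
      have h0 : s ^ 2 * (-3 * a ^ 2 - 4) = 0 := by linear_combination -hprod
      exact (mul_eq_zero.mp h0).resolve_left (pow_ne_zero 2 hs)
    exact hns ⟨0, by rw [this, zero_mul]⟩
  refine ⟨(-a + e) / 2, (-a - e) / 2, ?_, ?_, by field_simp; ring⟩
  · intro h
    field_simp at h
    have : 2 * e = 0 := by linear_combination h
    exact (mul_ne_zero h2 he0) this
  · ext y
    rw [mem_depressedRoots_iff h2 h1]
    simp only [Finset.mem_insert, Finset.mem_singleton]
    constructor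
    · rintro (hy | hy)
      · have : (2 * y + a - e) * (2 * y + a + e) = 0 := by linear_combination hy + he
        rcases mul_eq_zero.mp this with h | h
        · left
          field_simp
          linear_combination h
        · right
          field_simp
          linear_combination h
      · refine absurd ⟨e * (2 * y - a) / s, ?_⟩ hns
        field_simp
        linear_combination -hprod - e ^ 2 * hy
    · rintro (rfl | rfl) <;> left <;> field_simp <;> linear_combination -he

lemma depressedRoots_eq_of_mem_rootPairs {a s : F} (h2 : (2 : F) ≠ 0)
    (h : (a, s) ∈ rootPairs F) :
    ∃ y z : F, y ≠ z ∧ depressedRoots (a ^ 2 * s) = {y, z} ∧ (y + z = a ∨ y + z = -a) := by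
  by_cases hD : IsSquare (-s * (2 * a + s))
  · obtain ⟨y, z, hyz, hr, hsum⟩ := depressedRoots_eq_of_isSquare h2 h hD
    exact ⟨y, z, hyz, hr, Or.inr hsum⟩
  · have hD' : IsSquare (-s * (2 * -a + s)) := by
      by_contra hD'
      obtain ⟨h1, hs, hns⟩ := mem_rootPairs.mp h
      obtain ⟨t, ht⟩ := isSquare_mul_of_not_isSquare hD hD'
      refine hns ⟨t / s, ?_⟩
      field_simp
      linear_combination ht - s ^ 2 * h1
    obtain ⟨y, z, hyz, hr, hsum⟩ :=
      depressedRoots_eq_of_isSquare h2 (neg_fst_mem_rootPairs h) hD'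
    rw [neg_sq] at hr
    exact ⟨y, z, hyz, hr, Or.inl (by rw [hsum, neg_neg])⟩

/-- If the quartic has exactly the two roots `y ≠ z`, it comes from the pair
`(y + z, d / (y + z)²)`. -/
lemma mem_rootPairs_of_depressedRoots_eq {d y z : F} (h2 : (2 : F) ≠ 0) (hd : d ≠ 0)
    (hyz : y ≠ z) (hr : depressedRoots d = {y, z}) :
    y + z ≠ 0 ∧ (y + z, d / (y + z) ^ 2) ∈ rootPairs F := by
  have hy : y ^ 4 - 2 * y ^ 2 + 1 - d * y = 0 := by
    rw [← mem_depressedRoots, hr]; simp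
  have hz : z ^ 4 - 2 * z ^ 2 + 1 - d * z = 0 := by
    rw [← mem_depressedRoots, hr]; simp
  have hyz' : y - z ≠ 0 := sub_ne_zero.mpr hyz
  have hd' : d = (y + z) * (y ^ 2 + z ^ 2 - 2) := by
    apply mul_left_cancel₀ hyz'
    linear_combination hz - hy
  have hvw : y * z * (y ^ 2 + y * z + z ^ 2 - 2) = 1 := by
    linear_combination -hy - y * hd'
  have ha : y + z ≠ 0 := by
    intro h
    exact hd (by rw [hd', h, zero_mul])
  obtain ⟨a, rfl⟩ : ∃ a, z = a - y := ⟨y + z, by ring⟩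
  simp only [add_sub_cancel] at *
  obtain ⟨s, rfl⟩ : ∃ s, d = a ^ 2 * s := ⟨d / a ^ 2, by field_simp⟩
  have hs : s ≠ 0 := right_ne_zero_of_mul hd
  have has : a * s = y ^ 2 + (a - y) ^ 2 - 2 := by
    apply mul_left_cancel₀ ha
    linear_combination hd'
  have hsq : s ^ 2 = a ^ 2 - 4 := by
    apply mul_left_cancel₀ (pow_ne_zero 2 ha)
    linear_combination (a * s + (y ^ 2 + (a - y) ^ 2 - 2)) * has - 4 * hvw
  rw [mul_div_cancel_left₀ _ (pow_ne_zero 2 ha)]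
  refine ⟨ha, mem_rootPairs.mpr ⟨hsq, hs, ?_⟩⟩
  rintro ⟨t, ht⟩
  have hD : (y - (a - y)) ^ 2 = s * (2 * a - s) := by
    linear_combination -2 * has + hsq
  have hprod : s * (2 * a - s) * (-s * (2 * a + s)) = (s * t) ^ 2 := by
    linear_combination s ^ 2 * ht + s ^ 2 * hsq
  have he : (s * t / (y - (a - y))) ^ 2 = -s * (2 * a + s) := by
    rw [div_pow, ← hprod, ← hD, mul_div_cancel_left₀ _ (pow_ne_zero 2 hyz')]
  generalize s * t / (y - (a - y)) = e at he
  have hmem (c : F) (hc : c ^ 2 = e ^ 2) : (-a + c) / 2 = y ∨ (-a + c) / 2 = a - y := by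
    have : (-a + c) / 2 ∈ depressedRoots (a ^ 2 * s) := by
      rw [mem_depressedRoots_iff h2 hsq]
      left
      field_simp
      linear_combination hc + he
    simpa [hr] using this
  have h4 : (4 : F) ≠ 0 := by
    have := pow_ne_zero 2 h2
    norm_num at this
    exact this
  have hplus := hmem e rfl
  have hminus := hmem (-e) (by ring)
  field_simp at hplus hminus
  have no_double (r : F) (he0 : e = 0) (har : a = -2 * r)
      (hasr : a * s = r ^ 2 + (a - r) ^ 2 - 2) : False := by
    have hsa : 2 * a + s = 0 := by
      have h0 : -s * (2 * a + s) = 0 := by rw [← he, he0, zero_pow two_ne_zero]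
      exact (mul_eq_zero.mp h0).resolve_left (neg_ne_zero.mpr hs)
    obtain rfl : s = -2 * a := by linear_combination hsa
    subst har
    have h18 : 2 * (9 * r ^ 2 - 1) = 0 := by linear_combination -hasr
    have h9 := (mul_eq_zero.mp h18).resolve_left h2
    have h12 : 4 * (3 * r ^ 2 + 1) = 0 := by linear_combination hsq
    have h3 := (mul_eq_zero.mp h12).resolve_left h4
    exact h4 (by linear_combination 3 * h3 - h9)
  have hee (h : 2 * e = 0) : e = 0 := (mul_eq_zero.mp h).resolve_left h2
  rcases hplus with h | h <;> rcases hminus with h' | h'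
  · have he0 := hee (by linear_combination h - h')
    exact no_double y he0 (by linear_combination he0 - h) has
  · exact mul_ne_zero h4 ha (by linear_combination -h - h')
  · exact mul_ne_zero h4 ha (by linear_combination -h - h')
  · have he0 := hee (by linear_combination h - h')
    exact no_double (a - y) he0 (by linear_combination he0 - h) (by linear_combination has)

lemma card_rootPairs_eq_two_mul_card_depressedRoots (h2 : (2 : F) ≠ 0) :
    (rootPairs F).card =
      2 * (Finset.univ.filter fun d : F => d ≠ 0 ∧ (depressedRoots d).card = 2).card := by
  refine card_eq_two_mul_card_of_fiber_eq_pair (fun q => q.1 ^ 2 * q.2) (fun q => (-q.1, q.2))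
    ?_ ?_ ?_ ?_
  · rintro ⟨a, s⟩ h
    obtain ⟨y, z, hyz, hr, -⟩ := depressedRoots_eq_of_mem_rootPairs h2 h
    simp only [Finset.mem_filter, Finset.mem_univ, true_and]
    refine ⟨mul_ne_zero (pow_ne_zero 2 (fst_ne_zero_of_mem_rootPairs h))
      (mem_rootPairs.mp h).2.1, ?_⟩
    rw [hr, Finset.card_pair hyz]
  · rintro ⟨a, s⟩ h
    refine ⟨neg_fst_mem_rootPairs h, by simp, fun hq => ?_⟩
    exact ne_neg_self_of_two_ne_zero h2 (fst_ne_zero_of_mem_rootPairs h) (congrArg Prod.fst hq)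
  · rintro ⟨a, s⟩ h ⟨a', s'⟩ h' hd
    simp only at hd
    obtain ⟨y, z, hyz, hr, hsum⟩ := depressedRoots_eq_of_mem_rootPairs h2 h
    obtain ⟨y', z', hyz', hr', hsum'⟩ := depressedRoots_eq_of_mem_rootPairs h2 h'
    have hadd : y' + z' = y + z := by
      have hpair : ({y', z'} : Finset F) = {y, z} := by rw [← hr', hd, hr]
      simpa [Finset.sum_pair hyz, Finset.sum_pair hyz'] using
        congrArg (fun t : Finset F => ∑ x ∈ t, x) hpair
    have haa : a' = a ∨ a' = -a := by grind
    have hss : s' = s := by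
      have hsq : a' ^ 2 = a ^ 2 := sq_eq_sq_iff_eq_or_eq_neg.mpr haa
      rw [hsq] at hd
      exact mul_left_cancel₀ (pow_ne_zero 2 (fst_ne_zero_of_mem_rootPairs h)) hd
    simpa [hss] using haa
  · intro d hd
    simp only [Finset.mem_filter, Finset.mem_univ, true_and] at hd
    obtain ⟨y, z, hyz, hr⟩ := Finset.card_eq_two.mp hd.2
    obtain ⟨ha, hmem⟩ := mem_rootPairs_of_depressedRoots_eq h2 hd.1 hyz hr
    exact ⟨_, hmem, mul_div_cancel₀ _ (pow_ne_zero 2 ha)⟩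

open Classical in
lemma card_rootPairs_eq_two_mul_card_fst (h2 : (2 : F) ≠ 0) :
    (rootPairs F).card =
      2 * (Finset.univ.filter fun a : F =>
        (a ^ 2 - 4 ≠ 0 ∧ IsSquare (a ^ 2 - 4)) ∧ ¬ IsSquare (-3 * a ^ 2 - 4)).card := by
  refine card_eq_two_mul_card_of_fiber_eq_pair Prod.fst (fun q => (q.1, -q.2)) ?_ ?_ ?_ ?_
  · rintro ⟨a, s⟩ h
    obtain ⟨h1, hs, hns⟩ := mem_rootPairs.mp h
    simp only [Finset.mem_filter, Finset.mem_univ, true_and]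
    rw [← h1]
    exact ⟨⟨pow_ne_zero 2 hs, IsSquare.sq s⟩, hns⟩
  · rintro ⟨a, s⟩ h
    refine ⟨neg_snd_mem_rootPairs h, rfl, fun hq => ?_⟩
    exact ne_neg_self_of_two_ne_zero h2 (mem_rootPairs.mp h).2.1 (congrArg Prod.snd hq)
  · rintro ⟨a, s⟩ h ⟨a', s'⟩ h' (rfl : a' = a)
    have hss : s' ^ 2 = s ^ 2 := (mem_rootPairs.mp h').1.trans (mem_rootPairs.mp h).1.symm
    simpa using sq_eq_sq_iff_eq_or_eq_neg.mp hss
  · intro a ha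
    simp only [Finset.mem_filter, Finset.mem_univ, true_and] at ha
    obtain ⟨⟨h0, s, hs⟩, hns⟩ := ha
    refine ⟨(a, s), mem_rootPairs.mpr ⟨by rw [hs, sq], ?_, hns⟩, rfl⟩
    rintro rfl
    exact h0 (by rw [hs, zero_mul])

/-- The substitution `y = 2x + 1` matches the roots of `x⁴ + 2x³ + x² + 2cx + c` with those of
`y⁴ - 2y² + 1 + 16cy`. -/
lemma card_roots_eq_card_depressedRoots (h2 : (2 : F) ≠ 0) (c : F) :
    (Finset.univ.filter fun x : F =>
      x ^ 4 + 2 * x ^ 3 + x ^ 2 + 2 * c * x + c = 0).card =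
      (depressedRoots (-16 * c)).card := by
  have h16 : (16 : F) ≠ 0 := by
    have := pow_ne_zero 4 h2
    norm_num at this
    exact this
  have key (x : F) : (2 * x + 1) ^ 4 - 2 * (2 * x + 1) ^ 2 + 1 - -16 * c * (2 * x + 1) =
      16 * (x ^ 4 + 2 * x ^ 3 + x ^ 2 + 2 * c * x + c) := by ring
  refine Finset.card_bij (fun x _ => 2 * x + 1) ?_ ?_ ?_
  · intro x hx
    simp only [Finset.mem_filter, Finset.mem_univ, true_and] at hx
    rw [mem_depressedRoots, key, hx, mul_zero]
  · intro x _ x' _ h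
    exact mul_left_cancel₀ h2 (add_right_cancel h)
  · intro y hy
    have hxy : 2 * ((y - 1) / 2) + 1 = y := by field_simp; ring
    refine ⟨(y - 1) / 2, ?_, hxy⟩
    rw [mem_depressedRoots, ← hxy, key] at hy
    simpa using (mul_eq_zero.mp hy).resolve_left h16

end QuarticCount


/-- Let `A = {a ∈ F : η(a² - 4) = 1 and η(-3a² - 4) = -1}` and
`B = {b ∈ F, b ≠ 0 : g_b(x) = x⁴ + 2x³ + x² + 2b⁻¹x + b⁻¹ has exactly 2 roots in F}`,
where `F = GF(p^n)`.  Then `|A| = |B|`. -/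
theorem stmt_15 (p n : ℕ) (hp : p.Prime) (hp2 : p ≠ 2) (hn : 0 < n)
    (F : Type*) [Field F] [Fintype F] [DecidableEq F]
    (hF : Fintype.card F = p ^ n)
    (η : F → ℤ)
    (hη0 : η 0 = 0)
    (hη1 : ∀ x : F, x ≠ 0 → IsSquare x → η x = 1)
    (hη2 : ∀ x : F, ¬ IsSquare x → η x = -1) :
    (Finset.univ.filter
      (fun a : F => η (a ^ 2 - 4) = 1 ∧ η (-3 * a ^ 2 - 4) = -1)).card =
    (Finset.univ.filter
      (fun b : F => b ≠ 0 ∧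
        (Finset.univ.filter
          (fun x : F => x ^ 4 + 2 * x ^ 3 + x ^ 2 + 2 * b⁻¹ * x + b⁻¹ = 0)).card = 2)).card := by
  have h2 : (2 : F) ≠ 0 := by
    apply Ring.two_ne_zero
    rw [Ne, FiniteField.even_card_iff_char_two, hF, ← Nat.even_iff, Nat.even_pow]
    exact fun h => hp2 (hp.even_iff.mp h.1)
  have h16 : (-16 : F) ≠ 0 := by
    have := neg_ne_zero.mpr (pow_ne_zero 4 h2)
    norm_num at this ⊢
    exact this
  have hη_one (x : F) : η x = 1 ↔ x ≠ 0 ∧ IsSquare x := by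
    refine ⟨fun h => ⟨?_, ?_⟩, fun h => hη1 x h.1 h.2⟩
    · rintro rfl
      simp [hη0] at h
    · by_contra hx
      simp [hη2 x hx] at h
  have hη_neg (x : F) : η x = -1 ↔ ¬ IsSquare x := by
    refine ⟨fun h hx => ?_, hη2 x⟩
    by_cases h0 : x = 0
    · simp [h0, hη0] at h
    · simp [hη1 x h0 hx] at h
  have hA := (card_rootPairs_eq_two_mul_card_fst h2).symm.trans
    (card_rootPairs_eq_two_mul_card_depressedRoots h2)
  simp only [hη_one, hη_neg, card_roots_eq_card_depressedRoots h2]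
  trans (Finset.univ.filter fun d : F => d ≠ 0 ∧ (depressedRoots d).card = 2).card
  · convert Nat.eq_of_mul_eq_mul_left two_pos hA
  · symm
    refine Finset.card_bij (fun b _ => -16 * b⁻¹) ?_ ?_ ?_
    · intro b hb
      simp only [Finset.mem_filter, Finset.mem_univ, true_and] at hb ⊢
      exact ⟨mul_ne_zero h16 (inv_ne_zero hb.1), hb.2⟩
    · intro b _ b' _ h
      exact inv_injective (mul_left_cancel₀ h16 h)
    · intro d hd
      simp only [Finset.mem_filter, Finset.mem_univ, true_and] at hd
      have hbd : -16 * (-16 / d)⁻¹ = d := by rw [inv_div, mul_div_cancel₀ _ h16]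
      refine ⟨-16 / d, ?_, hbd⟩
      simp only [Finset.mem_filter, Finset.mem_univ, true_and, hbd]
      exact ⟨div_ne_zero h16 hd.1, hd.2⟩
end

section
/- Let p = 3, n ≥ 2, d = 3^n - 3, and for b ∈ F = GF(3^n) let N(b) be the number of x ∈ F with (x+1)^d - x^d = b. Let ω₂ be the number of b ∈ F with N(b) = 2. Then ω₂ = 0 if n is even, and ω₂ = (3^n - 3)/2 if n is odd. -/
namespace TernaryPower

variable {F : Type*} [Field F]

lemma cube_injective (h3 : (3 : F) = 0) {x y : F} (h : x ^ 3 = y ^ 3) : x = y := by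
  have : (x - y) ^ 3 = 0 := by linear_combination h + (x * y ^ 2 - x ^ 2 * y) * h3
  exact sub_eq_zero.1 (pow_eq_zero_iff three_ne_zero |>.1 this)

/-- A second point `y` of the fibre through `a` corresponds, via `w = a * y - a ^ 2 - 1`, to a root
of a cubic without linear term. -/
lemma fibre_iff_cubic (h3 : (3 : F) = 0) {a y : F} (ha : a ≠ 0) (hya : y ≠ a) :
    y * (a ^ 2 - 1) ^ 2 = a * (y ^ 2 - 1) ^ 2 ↔
      (a ^ 2 - 1) ^ 2 + a ^ 2 * (a * y - a ^ 2 - 1) ^ 2 + (a * y - a ^ 2 - 1) ^ 3 = 0 := by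
  have hw : (y - a) * ((a ^ 2 - 1) ^ 2 + a ^ 2 * (a * y - a ^ 2 - 1) ^ 2 +
      (a * y - a ^ 2 - 1) ^ 3) = a ^ 2 * (a * (y ^ 2 - 1) ^ 2 - y * (a ^ 2 - 1) ^ 2) := by
    grind
  rw [← mul_eq_zero_iff_left (sub_ne_zero.2 hya), hw, mul_eq_zero_iff_left (pow_ne_zero 2 ha),
    sub_eq_zero, eq_comm]

lemma cubic_ne_zero_at_self {a : F} (ha : a ≠ 0) (ha1 : a ^ 2 ≠ 1) :
    (a ^ 2 - 1) ^ 2 + a ^ 2 * (a * a - a ^ 2 - 1) ^ 2 + (a * a - a ^ 2 - 1) ^ 3 ≠ 0 := by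
  intro h
  have hfac : (a ^ 2 - 1) * a ^ 2 = 0 := by linear_combination h
  exact mul_ne_zero (sub_ne_zero.2 ha1) (pow_ne_zero 2 ha) hfac

/-- The reciprocal of a root of the cubic is a root of an affine linearized polynomial. -/
lemma cubic_iff_linearized {a w q : F} (ha1 : a ^ 2 ≠ 1)
    (hq : q * (a * w) = a ^ 2 - 1) :
    (a ^ 2 - 1) ^ 2 + a ^ 2 * w ^ 2 + w ^ 3 = 0 ↔ a ^ 3 * (q ^ 3 + q) = 1 - a ^ 2 := by
  have hA : a ^ 2 - 1 ≠ 0 := sub_ne_zero.2 ha1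
  have hw : w ≠ 0 := by rintro rfl; simp at hq; exact hA hq.symm
  have key : w ^ 3 * (a ^ 3 * (q ^ 3 + q) - (1 - a ^ 2)) =
      (a ^ 2 - 1) * ((a ^ 2 - 1) ^ 2 + a ^ 2 * w ^ 2 + w ^ 3) := by
    have h1 : (q * (a * w)) ^ 3 = (a ^ 2 - 1) ^ 3 := by rw [hq]
    linear_combination h1 + a ^ 2 * w ^ 2 * hq
  constructor
  · intro h
    rw [h, mul_zero] at key
    exact sub_eq_zero.1 ((mul_eq_zero.1 key).resolve_left (pow_ne_zero 3 hw))
  · intro h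
    rw [h, sub_self, mul_zero] at key
    exact (mul_eq_zero.1 key.symm).resolve_left hA

lemma cube_sq_ne_one (h3 : (3 : F) = 0) {a : F} (ha1 : a ^ 2 ≠ 1) : (a ^ 3) ^ 2 ≠ 1 := by
  intro h
  exact ha1 (cube_injective h3 (by linear_combination h))

lemma cube_ne_self {a : F} (ha : a ≠ 0) (ha1 : a ^ 2 ≠ 1) : a ^ 3 ≠ a := by
  intro h
  exact ha1 (mul_left_cancel₀ ha (by linear_combination h))

lemma linearized_injective (h3 : (3 : F) = 0) (hi : ¬ IsSquare (-1 : F)) :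
    Function.Injective fun q : F ↦ q ^ 3 + q := by
  intro q r h
  by_contra hqr
  apply hi
  refine ⟨q - r, ?_⟩
  apply mul_left_cancel₀ (sub_ne_zero.2 hqr)
  simp only at h
  linear_combination -h - (q * r ^ 2 - q ^ 2 * r) * h3

lemma pow_card_sub_three [Fintype F] {n : ℕ} (hn : 2 ≤ n) (hF : Fintype.card F = 3 ^ n) (x : F) :
    x ^ (3 ^ n - 3) = (x ^ 2)⁻¹ := by
  have h9 : 3 ^ 2 ≤ 3 ^ n := Nat.pow_le_pow_right (by norm_num) hn
  by_cases hx : x = 0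
  · subst hx
    rw [zero_pow (by omega)]
    simp
  · apply eq_inv_of_mul_eq_one_left
    rw [← pow_add, show 3 ^ n - 3 + 2 = Fintype.card F - 1 by omega,
      FiniteField.pow_card_sub_one_eq_one x hx]

/-- `x ↦ x / (x ^ 2 - 1) ^ 2`, corrected at `±1`. -/
def shiftedDiff [DecidableEq F] (y : F) : F :=
  if y = 1 then -1 else if y = -1 then 1 else y / (y ^ 2 - 1) ^ 2

variable [DecidableEq F]

lemma shiftedDiff_of_sq_ne_one {y : F} (hy : y ^ 2 ≠ 1) :
    shiftedDiff y = y / (y ^ 2 - 1) ^ 2 := by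
  have := not_or.1 (sq_eq_one_iff.not.1 hy)
  simp [shiftedDiff, this.1, this.2]

lemma shiftedDiff_eq_zero_iff {y : F} : shiftedDiff y = 0 ↔ y = 0 := by
  unfold shiftedDiff
  split_ifs with h1 h2
  · simp [h1]
  · simp [h2]
  · have hy : y ^ 2 - 1 ≠ 0 := sub_ne_zero.2 (sq_eq_one_iff.not.2 (not_or.2 ⟨h1, h2⟩))
    simp [hy]

lemma shiftedDiff_eq_iff {a y : F} (ha : a ^ 2 ≠ 1) (hy : y ^ 2 ≠ 1) :
    shiftedDiff y = shiftedDiff a ↔ y * (a ^ 2 - 1) ^ 2 = a * (y ^ 2 - 1) ^ 2 := by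
  rw [shiftedDiff_of_sq_ne_one ha, shiftedDiff_of_sq_ne_one hy, div_eq_div_iff]
  · exact pow_ne_zero 2 (sub_ne_zero.2 hy)
  · exact pow_ne_zero 2 (sub_ne_zero.2 ha)

lemma shiftedDiff_sq_of_sq_eq_one {y : F} (hy : y ^ 2 = 1) : shiftedDiff y ^ 2 = 1 := by
  unfold shiftedDiff
  split_ifs with h1 h2
  · simp
  · simp
  · exact absurd hy (sq_eq_one_iff.not.2 (not_or.2 ⟨h1, h2⟩))

lemma shiftedDiff_injOn_sq_eq_one (h3 : (3 : F) = 0) {x y : F} (hx : x ^ 2 = 1) (hy : y ^ 2 = 1)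
    (h : shiftedDiff x = shiftedDiff y) : x = y := by
  have h2 : (-1 : F) ≠ 1 := by
    intro h2
    exact one_ne_zero (by linear_combination h2 + h3 : (1 : F) = 0)
  rcases sq_eq_one_iff.1 hx with rfl | rfl <;> rcases sq_eq_one_iff.1 hy with rfl | rfl <;>
    simp_all [shiftedDiff, eq_comm]

/-- The points of the fibre through `a` other than `a` are parametrized by the roots of an affine
linearized polynomial. -/
lemma exists_linearized_of_fibre (h3 : (3 : F) = 0) {a y : F} (ha : a ≠ 0) (ha1 : a ^ 2 ≠ 1)
    (hy1 : y ^ 2 ≠ 1) (hya : y ≠ a) (h : shiftedDiff y = shiftedDiff a) :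
    ∃ q, a ^ 3 * (q ^ 3 + q) = 1 - a ^ 2 ∧ q * (a * (a * y - a ^ 2 - 1)) = a ^ 2 - 1 := by
  have hc := (fibre_iff_cubic h3 ha hya).1 ((shiftedDiff_eq_iff ha1 hy1).1 h)
  have hw : a * y - a ^ 2 - 1 ≠ 0 := by
    intro hw
    rw [hw] at hc
    simp [sub_eq_zero, ha1] at hc
  have hq : (a ^ 2 - 1) / (a * (a * y - a ^ 2 - 1)) * (a * (a * y - a ^ 2 - 1)) = a ^ 2 - 1 :=
    div_mul_cancel₀ _ (mul_ne_zero ha hw)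
  exact ⟨_, (cubic_iff_linearized ha1 hq).1 hc, hq⟩

lemma exists_fibre_of_linearized (h3 : (3 : F) = 0) {a q : F} (ha : a ≠ 0) (ha1 : a ^ 2 ≠ 1)
    (hq : a ^ 3 * (q ^ 3 + q) = 1 - a ^ 2) :
    ∃ y, y ^ 2 ≠ 1 ∧ y ≠ a ∧ shiftedDiff y = shiftedDiff a ∧
      q * (a * (a * y - a ^ 2 - 1)) = a ^ 2 - 1 := by
  have hA : a ^ 2 - 1 ≠ 0 := sub_ne_zero.2 ha1
  have hq0 : q ≠ 0 := by
    rintro rfl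
    apply hA
    linear_combination hq
  obtain ⟨y, hy⟩ : ∃ y, q * (a * (a * y - a ^ 2 - 1)) = a ^ 2 - 1 := by
    refine ⟨((a ^ 2 - 1) / (q * a) + a ^ 2 + 1) / a, ?_⟩
    field_simp
    ring
  have hc := (cubic_iff_linearized ha1 hy).2 hq
  have hya : y ≠ a := by
    rintro rfl
    exact cubic_ne_zero_at_self ha ha1 hc
  have he := (fibre_iff_cubic h3 ha hya).2 hc
  have hy1 : y ^ 2 ≠ 1 := by
    intro hy1
    rw [hy1, sub_self] at he
    have : y = 0 := by simpa [hA] using he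
    simp [this] at hy1
  exact ⟨y, hy1, hya, (shiftedDiff_eq_iff ha1 hy1).2 he, hy⟩

lemma exists_third_of_isSquare (h3 : (3 : F) = 0) (hi : IsSquare (-1 : F)) {a y : F} (ha : a ≠ 0)
    (ha1 : a ^ 2 ≠ 1) (hy1 : y ^ 2 ≠ 1) (hya : y ≠ a) (h : shiftedDiff y = shiftedDiff a) :
    ∃ z, z ≠ a ∧ z ≠ y ∧ shiftedDiff z = shiftedDiff a := by
  obtain ⟨i, hi⟩ := hi
  obtain ⟨q, hq, hqy⟩ := exists_linearized_of_fibre h3 ha ha1 hy1 hya h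
  have hqi : a ^ 3 * ((q + i) ^ 3 + (q + i)) = 1 - a ^ 2 := by
    rw [← hq]
    linear_combination (a ^ 3 * (q ^ 2 * i + q * i ^ 2)) * h3 - a ^ 3 * i * hi
  obtain ⟨z, -, hza, hz, hqz⟩ := exists_fibre_of_linearized h3 ha ha1 hqi
  refine ⟨z, hza, ?_, hz⟩
  rintro rfl
  have : i * (a * (a * z - a ^ 2 - 1)) = 0 := by linear_combination hqz - hqy
  have hi0 : i ≠ 0 := by rintro rfl; simp at hi
  rw [(mul_eq_zero.1 this).resolve_left hi0, mul_zero] at hqy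
  exact ha1 (sub_eq_zero.1 hqy.symm)

lemma shiftedDiff_cube (h3 : (3 : F) = 0) {a : F} (ha1 : a ^ 2 ≠ 1) :
    shiftedDiff (a ^ 3) = shiftedDiff a ^ 3 := by
  have hfac : (a ^ 3) ^ 2 - 1 = (a ^ 2 - 1) ^ 3 := by
    linear_combination (a ^ 4 - a ^ 2) * h3
  have : (a ^ 3) ^ 2 ≠ 1 := by
    rw [← sub_ne_zero, hfac]
    exact pow_ne_zero 3 (sub_ne_zero.2 ha1)
  rw [shiftedDiff_of_sq_ne_one ha1, shiftedDiff_of_sq_ne_one this, hfac, div_pow]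
  ring

lemma fibre_unique (h3 : (3 : F) = 0) (hi : ¬ IsSquare (-1 : F)) {a y z : F} (ha : a ≠ 0)
    (ha1 : a ^ 2 ≠ 1) (hy1 : y ^ 2 ≠ 1) (hya : y ≠ a) (hy : shiftedDiff y = shiftedDiff a)
    (hz1 : z ^ 2 ≠ 1) (hza : z ≠ a) (hz : shiftedDiff z = shiftedDiff a) : y = z := by
  obtain ⟨q, hq, hqy⟩ := exists_linearized_of_fibre h3 ha ha1 hy1 hya hy
  obtain ⟨r, hr, hrz⟩ := exists_linearized_of_fibre h3 ha ha1 hz1 hza hz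
  obtain rfl : q = r :=
    linearized_injective h3 hi (mul_left_cancel₀ (pow_ne_zero 3 ha) (hq.trans hr.symm))
  have hq0 : q ≠ 0 := by
    rintro rfl
    exact ha1 (by linear_combination -hqy)
  have : (q * a ^ 2) * y = (q * a ^ 2) * z := by linear_combination hqy - hrz
  exact mul_left_cancel₀ (mul_ne_zero hq0 (pow_ne_zero 2 ha)) this

/-- No regular point has the same value as one of the exceptional points `±1` when `-1` is not a
square. -/
lemma shiftedDiff_sq_ne_one (h3 : (3 : F) = 0) (hi : ¬ IsSquare (-1 : F)) {a : F} (ha : a ≠ 0)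
    (ha1 : a ^ 2 ≠ 1) : shiftedDiff a ^ 2 ≠ 1 := by
  intro h
  have h1 : shiftedDiff a ^ 3 = shiftedDiff a := by linear_combination shiftedDiff a * h
  have hb1 := cube_sq_ne_one h3 ha1
  have hb : shiftedDiff (a ^ 3) = shiftedDiff a := by rw [shiftedDiff_cube h3 ha1, h1]
  have hc : shiftedDiff ((a ^ 3) ^ 3) = shiftedDiff a := by
    rw [shiftedDiff_cube h3 hb1, hb, h1]
  have hba := cube_ne_self ha ha1
  have hca : (a ^ 3) ^ 3 ≠ a := by
    intro hca
    have h0 : (a * (a ^ 2 - 1)) * ((a ^ 2 + 1) * (a ^ 4 + 1)) = 0 := by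
      linear_combination hca
    rcases mul_eq_zero.1 ((mul_eq_zero.1 h0).resolve_left
      (mul_ne_zero ha (sub_ne_zero.2 ha1))) with h2 | h2
    · exact hi ⟨a, by linear_combination -h2⟩
    · exact hi ⟨a ^ 2, by linear_combination -h2⟩
  have := fibre_unique h3 hi ha ha1 hb1 hba hb (cube_sq_ne_one h3 hb1) hca hc
  exact hba (cube_injective h3 this.symm)

lemma pow_diff_eq_shiftedDiff [Fintype F] (h3 : (3 : F) = 0) {n : ℕ} (hn : 2 ≤ n)
    (hF : Fintype.card F = 3 ^ n) (x : F) :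
    (x + 1) ^ (3 ^ n - 3) - x ^ (3 ^ n - 3) = shiftedDiff (x - 1) := by
  rw [pow_card_sub_three hn hF, pow_card_sub_three hn hF]
  unfold shiftedDiff
  split_ifs with h1 h2
  · have : x = -1 := by linear_combination h1 + h3
    simp [this]
  · have : x = 0 := by linear_combination h2
    simp [this]
  · have hx : x ≠ 0 := by
      rintro rfl
      simp at h2
    have hx1 : x + 1 ≠ 0 := fun h ↦ h1 (by linear_combination h - h3)
    have : (x - 1) ^ 2 - 1 = x * (x + 1) := by linear_combination -x * h3
    rw [this]
    field_simp
    linear_combination -x * h3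

variable [Fintype F]

lemma card_fibre_ne_two_of_isSquare (h3 : (3 : F) = 0) (hi : IsSquare (-1 : F)) (b : F) :
    (Finset.univ.filter fun y : F ↦ shiftedDiff y = b).card ≠ 2 := by
  intro hcard
  obtain ⟨x, y, hxy, hs⟩ := Finset.card_eq_two.1 hcard
  have hmem (z : F) : shiftedDiff z = b ↔ z = x ∨ z = y := by
    simpa using congrArg (z ∈ ·) hs
  wlog hx1 : x ^ 2 ≠ 1 generalizing x y
  · by_cases hy1 : y ^ 2 = 1
    · exact hxy (shiftedDiff_injOn_sq_eq_one h3 (not_not.1 hx1) hy1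
        (((hmem x).2 (.inl rfl)).trans ((hmem y).2 (.inr rfl)).symm))
    · exact this y x hxy.symm (by rw [hs, Finset.pair_comm]) (fun z ↦ by rw [hmem, or_comm]) hy1
  have hx := (hmem x).2 (.inl rfl)
  have hy := (hmem y).2 (.inr rfl)
  have hx0 : x ≠ 0 := by
    rintro rfl
    rw [shiftedDiff_eq_zero_iff.2 rfl] at hx
    rw [← hx, shiftedDiff_eq_zero_iff] at hy
    exact hxy hy.symm
  by_cases hy1 : y ^ 2 = 1
  · have hb := shiftedDiff_sq_of_sq_eq_one hy1
    rw [hy] at hb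
    have : shiftedDiff (x ^ 3) = b := by
      rw [shiftedDiff_cube h3 hx1, hx]
      linear_combination b * hb
    rcases (hmem _).1 this with h | h
    · exact cube_ne_self hx0 hx1 h
    · exact cube_sq_ne_one h3 hx1 (h ▸ hy1)
  · obtain ⟨z, hzx, hzy, hz⟩ :=
      exists_third_of_isSquare h3 hi hx0 hx1 hy1 hxy.symm (hy.trans hx.symm)
    exact ((hmem z).1 (hz.trans hx)).elim hzx hzy

lemma card_fibre_eq_two (h3 : (3 : F) = 0) (hi : ¬ IsSquare (-1 : F)) {a : F} (ha : a ≠ 0)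
    (ha1 : a ^ 2 ≠ 1) :
    (Finset.univ.filter fun y : F ↦ shiftedDiff y = shiftedDiff a).card = 2 := by
  obtain ⟨q, hq⟩ := Finite.surjective_of_injective (linearized_injective h3 hi)
    ((1 - a ^ 2) / a ^ 3)
  have hq : a ^ 3 * (q ^ 3 + q) = 1 - a ^ 2 := by
    simp only at hq
    rw [hq, mul_div_cancel₀ _ (pow_ne_zero 3 ha)]
  obtain ⟨y, hy1, hya, hy, -⟩ := exists_fibre_of_linearized h3 ha ha1 hq
  refine Finset.card_eq_two.2 ⟨a, y, hya.symm, ?_⟩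
  ext z
  simp only [Finset.mem_filter_univ, Finset.mem_insert, Finset.mem_singleton]
  constructor
  · intro hz
    by_cases hza : z = a
    · exact .inl hza
    · have hz1 : z ^ 2 ≠ 1 := fun hz1 ↦
        shiftedDiff_sq_ne_one h3 hi ha ha1 (hz ▸ shiftedDiff_sq_of_sq_eq_one hz1)
      exact .inr (fibre_unique h3 hi ha ha1 hz1 hza hz hy1 hya hy)
  · rintro (rfl | rfl)
    · rfl
    · exact hy

lemma regular_of_card_fibre_eq_two (h3 : (3 : F) = 0) (hi : ¬ IsSquare (-1 : F)) {a : F}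
    (h : (Finset.univ.filter fun y : F ↦ shiftedDiff y = shiftedDiff a).card = 2) :
    a ≠ 0 ∧ a ^ 2 ≠ 1 := by
  obtain ⟨y, hy, hya⟩ := Finset.exists_mem_ne (h ▸ one_lt_two) a
  rw [Finset.mem_filter_univ] at hy
  constructor
  · rintro rfl
    rw [shiftedDiff_eq_zero_iff.2 rfl, shiftedDiff_eq_zero_iff] at hy
    exact hya hy
  · intro ha1
    by_cases hy1 : y ^ 2 = 1
    · exact hya (shiftedDiff_injOn_sq_eq_one h3 hy1 ha1 hy)
    · have hb := shiftedDiff_sq_of_sq_eq_one ha1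
      refine shiftedDiff_sq_ne_one h3 hi ?_ hy1 (hy ▸ hb)
      rintro rfl
      rw [← hy, shiftedDiff_eq_zero_iff.2 rfl] at hb
      simp at hb

lemma two_mul_card_fibre_eq_two (h3 : (3 : F) = 0) (hi : ¬ IsSquare (-1 : F)) :
    2 * (Finset.univ.filter fun b : F ↦
      (Finset.univ.filter fun y : F ↦ shiftedDiff y = b).card = 2).card + 3 =
      Fintype.card F := by
  set S := Finset.univ.filter fun b : F ↦
    (Finset.univ.filter fun y : F ↦ shiftedDiff y = b).card = 2 with hS
  set T := Finset.univ.filter fun a : F ↦ a ≠ 0 ∧ a ^ 2 ≠ 1 with hT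
  have hTS : ∀ a ∈ T, shiftedDiff a ∈ S := by
    intro a ha
    rw [hT, Finset.mem_filter_univ] at ha
    rw [hS, Finset.mem_filter_univ]
    exact card_fibre_eq_two h3 hi ha.1 ha.2
  have hcard : T.card = 2 * S.card := by
    rw [Finset.card_eq_sum_card_fiberwise hTS, mul_comm]
    refine Finset.sum_const_nat fun b hb ↦ ?_
    rw [hS, Finset.mem_filter_univ] at hb
    rw [← hb]
    congr 1
    ext y
    simp only [hT, Finset.mem_filter, Finset.mem_univ, true_and, and_iff_right_iff_imp]
    rintro rfl
    exact regular_of_card_fibre_eq_two h3 hi hb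
  have hcompl : Tᶜ = {0, 1, -1} := by
    ext y
    simp only [hT, Finset.mem_compl, Finset.mem_filter_univ, Finset.mem_insert,
      Finset.mem_singleton, ← sq_eq_one_iff]
    tauto
  have h2 : (1 : F) ≠ -1 := by
    intro h2
    exact one_ne_zero (by linear_combination h3 - h2 : (1 : F) = 0)
  have hcompl_card : Tᶜ.card = 3 := by
    rw [hcompl]
    exact Finset.card_eq_three.2 ⟨0, 1, -1, zero_ne_one, by simp, h2, rfl⟩
  rw [← hcard, ← hcompl_card, Finset.card_add_card_compl]

lemma card_pow_diff_fibre (h3 : (3 : F) = 0) {n : ℕ} (hn : 2 ≤ n)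
    (hF : Fintype.card F = 3 ^ n) (b : F) :
    (Finset.univ.filter fun x : F ↦ (x + 1) ^ (3 ^ n - 3) - x ^ (3 ^ n - 3) = b).card =
      (Finset.univ.filter fun y : F ↦ shiftedDiff y = b).card :=
  Finset.card_equiv (Equiv.subRight 1) fun x ↦ by simp [pow_diff_eq_shiftedDiff h3 hn hF]

end TernaryPower

/-- For `p = 3`, `n ≥ 2`, `d = 3^n - 3`, `N(b) = #{x ∈ F : (x+1)^d - x^d = b}`
and `ω₂ = #{b ∈ F : N(b) = 2}`: `ω₂ = 0` if `n` is even and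
`ω₂ = (3^n - 3)/2` if `n` is odd. -/
theorem stmt_16 (n : ℕ) (hn : 2 ≤ n)
    (F : Type*) [Field F] [Fintype F] [DecidableEq F]
    (hF : Fintype.card F = 3 ^ n) :
    (Even n →
      (Finset.univ.filter (fun b : F =>
        (Finset.univ.filter
          (fun x : F => (x + 1) ^ (3 ^ n - 3) - x ^ (3 ^ n - 3) = b)).card = 2)).card = 0) ∧
    (Odd n →
      (Finset.univ.filter (fun b : F =>
        (Finset.univ.filter
          (fun x : F => (x + 1) ^ (3 ^ n - 3) - x ^ (3 ^ n - 3) = b)).card = 2)).card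
        = (3 ^ n - 3) / 2) := by
  have h3 : (3 : F) = 0 := by
    have h := FiniteField.cast_card_eq_zero F
    rw [hF] at h
    push_cast at h
    exact pow_eq_zero_iff (by omega) |>.1 h
  have hsq : IsSquare (-1 : F) ↔ 3 ^ n % 4 ≠ 3 := hF ▸ FiniteField.isSquare_neg_one_iff
  simp only [TernaryPower.card_pow_diff_fibre h3 hn hF]
  constructor
  · rintro ⟨k, rfl⟩
    have hi : IsSquare (-1 : F) := by
      rw [hsq, ← two_mul, pow_mul, Nat.pow_mod]
      norm_num
    rw [Finset.card_eq_zero, Finset.filter_eq_empty_iff]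
    exact fun b _ ↦ TernaryPower.card_fibre_ne_two_of_isSquare h3 hi b
  · rintro ⟨k, rfl⟩
    have hi : ¬ IsSquare (-1 : F) := by
      rw [hsq, not_not, pow_succ, pow_mul, Nat.mul_mod, Nat.pow_mod]
      norm_num
    have := TernaryPower.two_mul_card_fibre_eq_two h3 hi
    omega
end
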